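/- arXiv:2604.17639 — 8 statements merged into one kernel-verified Lean document; each statement's English description precedes it below -/
import Mathlib

section
/- Let g : ℝ → ℝ be a smooth (C^∞), strictly positive, 2π-periodic function. Then ∫₀^{2π} |(log g)'(x)|² g(x) dx ≤ ∫₀^{2π} |(log g)''(x)|² g(x) dx. -/
open Real MeasureTheory

lemma wirtinger_aux (h h' : ℝ → ℝ) (hd : ∀ x, HasDerivAt h (h' x) x) (hc : Continuous h')
    (hb : h (2 * π) = h 0) (hz : ∫ x in (0:ℝ)..(2 * π), h x = 0) :
    ∫ x in (0:ℝ)..(2 * π), h x ^ 2 ≤ ∫ x in (0:ℝ)..(2 * π), h' x ^ 2 := by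
  have hab : (0:ℝ) < 2 * π := by positivity
  have hch : Continuous h := continuous_iff_continuousAt.2 fun x => (hd x).continuousAt
  have key : ∀ k : ℝ → ℝ, Continuous k →
      HasSum (fun i => ‖fourierCoeffOn hab (fun x => (k x : ℂ)) i‖ ^ 2)
        ((2 * π)⁻¹ * ∫ x in (0:ℝ)..(2 * π), k x ^ 2) := by
    intro k hk
    have hk' : Continuous (fun x => (k x : ℂ)) := Complex.continuous_ofReal.comp hk
    have hL : MemLp (fun x => (k x : ℂ)) 2 (volume.restrict (Set.Ioc 0 (2 * π))) := by
      obtain ⟨C, hC⟩ := (isCompact_Icc (a := (0:ℝ)) (b := 2 * π)).exists_bound_of_continuousOn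
        hk'.continuousOn
      refine MemLp.of_bound hk'.aestronglyMeasurable C ?_
      filter_upwards [ae_restrict_mem measurableSet_Ioc] with x hx
      exact hC x (Set.Ioc_subset_Icc_self hx)
    have := hasSum_sq_fourierCoeffOn hab hL
    simpa using this
  have h1 := key h hch
  have h2 := key h' hc
  have hle := hasSum_le (fun n => ?_) h1 h2
  · exact le_of_mul_le_mul_left hle (by positivity)
  · by_cases hn : n = 0
    · subst hn
      have : fourierCoeffOn hab (fun x => (h x : ℂ)) 0 = 0 := by
        rw [fourierCoeffOn_eq_integral]
        simp [intervalIntegral.integral_ofReal, hz]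
      rw [this]
      simp
    · have e := fourierCoeffOn_of_hasDerivAt hab (f := fun x => (h x : ℂ))
        (f' := fun x => (h' x : ℂ)) hn (fun x _ => (hd x).ofReal_comp)
        ((Complex.continuous_ofReal.comp hc).intervalIntegrable _ _)
      rw [e, hb]
      have hn1 : (1:ℝ) ≤ |(n:ℝ)| := by
        exact_mod_cast Int.one_le_abs hn
      gcongr
      simp only [sub_self, mul_zero, zero_sub, norm_mul, norm_neg, norm_div, norm_one]
      simp only [Complex.ofReal_zero, Complex.ofReal_mul, sub_zero, norm_mul, Complex.norm_I,
        Complex.norm_real, Complex.norm_intCast, Complex.ofReal_ofNat, Complex.norm_ofNat,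
        Real.norm_eq_abs, abs_of_pos pi_pos, mul_one]
      have hpi := pi_pos
      rw [← mul_assoc]
      apply mul_le_of_le_one_left (norm_nonneg _)
      rw [div_mul_eq_mul_div, one_mul]
      apply (div_le_one (by positivity)).2
      nlinarith

/-- For a smooth, strictly positive, `2π`-periodic function `g : ℝ → ℝ`,
`∫₀^{2π} |(log g)'|² g ≤ ∫₀^{2π} |(log g)''|² g`. -/
theorem torus_log_derivative_inequality (g : ℝ → ℝ) (hg : ContDiff ℝ (⊤ : ℕ∞) g)
    (hpos : ∀ x, 0 < g x) (hper : Function.Periodic g (2 * π)) :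
    (∫ x in (0:ℝ)..(2 * π), (deriv (fun y => Real.log (g y)) x) ^ 2 * g x) ≤
      ∫ x in (0:ℝ)..(2 * π), (deriv (deriv (fun y => Real.log (g y))) x) ^ 2 * g x := by
  have hu : ContDiff ℝ (⊤ : ℕ∞) (fun y => Real.log (g y)) := hg.log fun x => (hpos x).ne'
  have hup : Function.Periodic (fun y => Real.log (g y)) (2 * π) := fun x => by simp only [hper x]
  have hgu : ∀ x, g x = Real.exp (Real.log (g x)) := fun x => (Real.exp_log (hpos x)).symm
  have hp1 : ContDiff ℝ (⊤ : ℕ∞) (deriv (fun y => Real.log (g y))) :=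
    (contDiff_infty_iff_deriv.1 hu).2
  have hq1 : ContDiff ℝ (⊤ : ℕ∞) (deriv (deriv (fun y => Real.log (g y)))) :=
    (contDiff_infty_iff_deriv.1 hp1).2
  have hdu : ∀ x, HasDerivAt (fun y => Real.log (g y)) (deriv (fun y => Real.log (g y)) x) x :=
    fun x => ((contDiff_infty_iff_deriv.1 hu).1 x).hasDerivAt
  have hdp : ∀ x, HasDerivAt (deriv (fun y => Real.log (g y)))
      (deriv (deriv (fun y => Real.log (g y))) x) x :=
    fun x => ((contDiff_infty_iff_deriv.1 hp1).1 x).hasDerivAt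
  have hpp : deriv (fun y => Real.log (g y)) (2 * π) = deriv (fun y => Real.log (g y)) 0 := by
    have := deriv_comp_add_const (fun y => Real.log (g y)) (2 * π) 0
    rw [zero_add] at this
    rw [← this]
    congr 1
    funext x
    exact hup x
  have hu0 : Real.log (g (2 * π)) = Real.log (g 0) := by
    have := hup 0
    simpa using this
  have cu := hu.continuous
  have cp := hp1.continuous
  have cq := hq1.continuous
  generalize hq : deriv (deriv (fun y => Real.log (g y))) = q at *
  generalize hp : deriv (fun y => Real.log (g y)) = p at *
  generalize hul : (fun y => Real.log (g y)) = u at *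
  have hux : ∀ x, Real.log (g x) = u x := fun x => congrFun hul x
  rw [hux, hux] at hu0
  have hgx : ∀ x, g x = Real.exp (u x) := fun x => by rw [← hux x]; exact hgu x
  simp_rw [hgx]
  clear hgx hq hp hul hux hgu hup hu hp1 hq1 hper hpos hg
  have hdf : ∀ x, HasDerivAt (fun x => Real.exp (u x / 2)) (p x / 2 * Real.exp (u x / 2)) x := by
    intro x
    convert ((hdu x).div_const 2).exp using 1
    ring
  have hdh : ∀ x, HasDerivAt (fun x => p x / 2 * Real.exp (u x / 2))
      ((q x / 2 + p x ^ 2 / 4) * Real.exp (u x / 2)) x := by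
    intro x
    refine HasDerivAt.congr_deriv (((hdp x).div_const 2).mul (hdf x)) ?_
    ring
  have hdw : ∀ x, HasDerivAt (fun x => p x ^ 3 / 3 * Real.exp (u x))
      ((q x * p x ^ 2 + p x ^ 4 / 3) * Real.exp (u x)) x := by
    intro x
    refine HasDerivAt.congr_deriv ((((hdp x).pow 3).div_const 3).mul (hdu x).exp) ?_
    simp only [Pi.pow_apply]
    push_cast
    ring
  have hsq : ∀ x, Real.exp (u x / 2) ^ 2 = Real.exp (u x) := by
    intro x
    rw [← Real.exp_nat_mul]
    congr 1
    push_cast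
    ring
  have W := wirtinger_aux _ _ hdh (by fun_prop) (by rw [hpp, hu0]) (by
    rw [intervalIntegral.integral_eq_sub_of_hasDerivAt (fun x _ => hdf x)
      (Continuous.intervalIntegrable (by fun_prop) _ _), hu0, sub_self])
  have Z : ∫ x in (0:ℝ)..(2 * π), (q x * p x ^ 2 + p x ^ 4 / 3) * Real.exp (u x) = 0 := by
    rw [intervalIntegral.integral_eq_sub_of_hasDerivAt (fun x _ => hdw x)
      (Continuous.intervalIntegrable (by fun_prop) _ _), hu0, hpp, sub_self]
  calc _ = 4 * ∫ x in (0:ℝ)..(2 * π), (p x / 2 * Real.exp (u x / 2)) ^ 2 := by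
        rw [← intervalIntegral.integral_const_mul]
        congr 1
        funext x
        rw [mul_pow, hsq]
        ring
    _ ≤ 4 * ∫ x in (0:ℝ)..(2 * π), ((q x / 2 + p x ^ 2 / 4) * Real.exp (u x / 2)) ^ 2 := by
        gcongr
    _ = ∫ x in (0:ℝ)..(2 * π), 4 * ((q x / 2 + p x ^ 2 / 4) * Real.exp (u x / 2)) ^ 2 := by
        rw [← intervalIntegral.integral_const_mul]
    _ ≤ ∫ x in (0:ℝ)..(2 * π), (q x ^ 2 * Real.exp (u x) +
          (q x * p x ^ 2 + p x ^ 4 / 3) * Real.exp (u x)) := by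
        apply intervalIntegral.integral_mono_on (by positivity)
          (Continuous.intervalIntegrable (by fun_prop) _ _)
          (Continuous.intervalIntegrable (by fun_prop) _ _)
        intro x _
        rw [mul_pow, hsq]
        have : 0 ≤ p x ^ 4 * Real.exp (u x) := by positivity
        nlinarith
    _ = _ := by
        rw [intervalIntegral.integral_add (Continuous.intervalIntegrable (by fun_prop) _ _)
          (Continuous.intervalIntegrable (by fun_prop) _ _), Z, add_zero]
end

section
/- Let η : ℝ^d → ℝ be a smooth (C^∞), strictly positive function that is 2π-periodic in each coordinate. Then ∫_{[0,2π]^d} |∇ log η(x)|² η(x) dx ≤ ∫_{[0,2π]^d} Σ_{i=1}^d |∂²_{x_i x_i} log η(x)|² η(x) dx ≤ ∫_{[0,2π]^d} |D² log η(x)|²_{HS} η(x) dx, where D² denotes the Hessian and |·|_{HS} the Hilbert–Schmidt (Frobenius) norm. -/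
open Real MeasureTheory

/-- Partial derivative of `f : ℝ^d → ℝ` in the `i`-th coordinate direction. -/
noncomputable def pd {d : ℕ} (f : (Fin d → ℝ) → ℝ) (i : Fin d) (x : Fin d → ℝ) : ℝ :=
  fderiv ℝ f x (Pi.single i 1)

/-- The fundamental cube `[0,2π]^d` of the torus `𝕋^d = (ℝ/2πℤ)^d`. -/
noncomputable def torusBox (d : ℕ) : Set (Fin d → ℝ) :=
  Set.Icc 0 (fun _ => 2 * π)

lemma aux_wirtinger (w w' : ℝ → ℝ) (hw : ∀ t, HasDerivAt w (w' t) t) (hc : Continuous w')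
    (hp : w (2 * π) = w 0) (h0 : ∫ t in (0:ℝ)..(2 * π), w t = 0) :
    ∫ t in (0:ℝ)..(2 * π), (w t) ^ 2 ≤ ∫ t in (0:ℝ)..(2 * π), (w' t) ^ 2 := by
  have hab : (0:ℝ) < 2 * π := by positivity
  have hwc : Continuous w := continuous_iff_continuousAt.2 fun t => (hw t).continuousAt
  have hL (f : ℝ → ℝ) (hf : Continuous f) :
      MemLp (fun t => (f t : ℂ)) 2 (volume.restrict (Set.Ioc 0 (2 * π))) := by
    have hc' : Continuous (fun t => (f t : ℂ)) := by fun_prop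
    have := (memLp_two_iff_integrable_sq_norm (μ := volume.restrict (Set.Ioc 0 (2 * π)))
      hc'.aestronglyMeasurable).2
    refine this ?_
    exact ((by fun_prop : Continuous fun t => ‖(f t : ℂ)‖ ^ 2).integrableOn_Icc).mono_set
      Set.Ioc_subset_Icc_self
  have h1 := hasSum_sq_fourierCoeffOn hab (hL w hwc)
  have h2 := hasSum_sq_fourierCoeffOn hab (hL w' hc)
  have key := hasSum_le (fun n => ?_) h1 h2
  · simp only [Complex.norm_real, Real.norm_eq_abs, sq_abs, smul_eq_mul, sub_zero] at key
    exact le_of_mul_le_mul_left key (by positivity)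
  · by_cases hn : n = 0
    · subst hn
      rw [fourierCoeffOn_eq_integral]
      simp only [neg_zero, fourier_zero, one_smul]
      rw [intervalIntegral.integral_ofReal, h0]
      simp
    · rw [fourierCoeffOn_of_hasDerivAt hab hn (f' := fun t => (w' t : ℂ))
        (fun t _ => (hw t).ofReal_comp)
        ((Complex.continuous_ofReal.comp hc).intervalIntegrable _ _), hp, sub_self, mul_zero,
        zero_sub]
      have hn1 : (1:ℝ) ≤ |(n:ℝ)| := by exact_mod_cast Int.one_le_abs hn
      gcongr
      rw [norm_mul, norm_neg, norm_mul]
      have : ‖(1:ℂ) / (-2 * π * Complex.I * n)‖ * ‖(((2 * π : ℝ) : ℂ) - ((0:ℝ):ℂ))‖ ≤ 1 := by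
        simp [abs_of_pos Real.pi_pos]
        field_simp
        exact hn1
      calc _ = ‖(1:ℂ) / (-2 * π * Complex.I * n)‖ * ‖(((2 * π : ℝ) : ℂ) - ((0:ℝ):ℂ))‖ *
          ‖fourierCoeffOn hab (fun t => (w' t : ℂ)) n‖ := by ring
        _ ≤ 1 * _ := by gcongr
        _ = _ := one_mul _

lemma aux_one_dim (V a b : ℝ → ℝ) (hV : ∀ t, HasDerivAt V (a t) t)
    (ha : ∀ t, HasDerivAt a (b t) t) (hb : Continuous b)
    (hpV : V (2 * π) = V 0) (hpa : a (2 * π) = a 0) :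
    0 ≤ ∫ t in (0:ℝ)..(2 * π), ((b t) ^ 2 - (a t) ^ 2) * Real.exp (V t) := by
  have hVc : Continuous V := continuous_iff_continuousAt.2 fun t => (hV t).continuousAt
  have hac : Continuous a := continuous_iff_continuousAt.2 fun t => (ha t).continuousAt
  have hu (t : ℝ) : HasDerivAt (fun t => Real.exp (V t / 2)) (a t / 2 * Real.exp (V t / 2)) t := by
    convert ((hV t).div_const 2).exp using 1
    ring
  have hw (t : ℝ) : HasDerivAt (fun t => a t / 2 * Real.exp (V t / 2))
      ((b t / 2 + (a t) ^ 2 / 4) * Real.exp (V t / 2)) t := by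
    refine (((ha t).div_const 2).fun_mul (hu t)).congr_deriv ?_
    ring
  have hsq (t : ℝ) : Real.exp (V t / 2) ^ 2 = Real.exp (V t) := by
    rw [← Real.exp_nat_mul]; congr 1; push_cast; ring
  have W := aux_wirtinger _ _ hw (by fun_prop) (by simp only [hpV, hpa]) (by
    rw [intervalIntegral.integral_eq_sub_of_hasDerivAt (fun t _ => hu t)
      (Continuous.intervalIntegrable (by fun_prop) _ _)]
    simp only [hpV, sub_self])
  have hF (t : ℝ) : HasDerivAt (fun t => (a t) ^ 3 / 3 * Real.exp (V t))
      (((a t) ^ 2 * b t + (a t) ^ 4 / 3) * Real.exp (V t)) t := by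
    refine ((((ha t).fun_pow 3).div_const 3).fun_mul (hV t).exp).congr_deriv ?_
    push_cast
    ring
  have F0 := intervalIntegral.integral_eq_sub_of_hasDerivAt (a := 0) (b := 2 * π) (fun t _ => hF t)
      (Continuous.intervalIntegrable (by fun_prop) _ _)
  simp only [hpV, hpa, sub_self] at F0
  have P : 0 ≤ ∫ t in (0:ℝ)..(2 * π), (a t) ^ 4 / 12 * Real.exp (V t) :=
    intervalIntegral.integral_nonneg (by positivity) (fun t _ => by positivity)
  have ii (f : ℝ → ℝ) (hf : Continuous f) : IntervalIntegrable f volume 0 (2 * π) :=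
    hf.intervalIntegrable _ _
  have E : ∫ t in (0:ℝ)..(2 * π), ((b t) ^ 2 - (a t) ^ 2) * Real.exp (V t) =
      4 * ((∫ t in (0:ℝ)..(2 * π), ((b t / 2 + (a t) ^ 2 / 4) * Real.exp (V t / 2)) ^ 2) -
        ∫ t in (0:ℝ)..(2 * π), (a t / 2 * Real.exp (V t / 2)) ^ 2) -
      (∫ t in (0:ℝ)..(2 * π), ((a t) ^ 2 * b t + (a t) ^ 4 / 3) * Real.exp (V t)) +
      ∫ t in (0:ℝ)..(2 * π), (a t) ^ 4 / 12 * Real.exp (V t) := by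
    rw [← intervalIntegral.integral_sub (ii _ (by fun_prop)) (ii _ (by fun_prop)),
      ← intervalIntegral.integral_const_mul,
      ← intervalIntegral.integral_sub (ii _ (by fun_prop)) (ii _ (by fun_prop)),
      ← intervalIntegral.integral_add (ii _ (by fun_prop)) (ii _ (by fun_prop))]
    congr 1
    ext t
    simp only [mul_pow, hsq]
    ring
  rw [E, F0]
  linarith

lemma aux_pd_contDiff {d : ℕ} {f : (Fin d → ℝ) → ℝ} (hf : ContDiff ℝ (⊤ : ℕ∞) f) (i : Fin d) :
    ContDiff ℝ (⊤ : ℕ∞) (pd f i) := by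
  unfold pd
  exact (hf.fderiv_right (by simp)).clm_apply contDiff_const

lemma aux_pd_slice {n : ℕ} {f : (Fin (n+1) → ℝ) → ℝ} (hf : ContDiff ℝ (⊤ : ℕ∞) f)
    (i : Fin (n+1)) (y : Fin n → ℝ) (t : ℝ) :
    HasDerivAt (fun t : ℝ => f (i.insertNth (α := fun _ => ℝ) t y))
      (pd f i (i.insertNth (α := fun _ => ℝ) t y)) t := by
  have h1 : HasDerivAt (fun t : ℝ => (i.insertNth (α := fun _ => ℝ) t y))
      (Pi.single i 1) t := by
    rw [hasDerivAt_pi]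
    intro j
    refine Fin.succAboveCases i ?_ (fun k => ?_) j
    · simpa using hasDerivAt_id' t
    · simpa using hasDerivAt_const t (y k)
  exact ((hf.differentiable (by simp) _).hasFDerivAt).comp_hasDerivAt t h1

lemma aux_insert {n : ℕ} (i : Fin (n+1)) (y : Fin n → ℝ) :
    (i.insertNth (α := fun _ => ℝ) (2 * π) y) =
      (i.insertNth (α := fun _ => ℝ) 0 y) + Pi.single i (2 * π) := by
  funext j
  refine Fin.succAboveCases i ?_ (fun k => ?_) j <;> simp

lemma aux_box {n : ℕ} (i : Fin (n+1)) (g : (Fin (n+1) → ℝ) → ℝ) (hg : Continuous g)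
    (h : ∀ y : Fin n → ℝ, 0 ≤ ∫ t in (0:ℝ)..(2 * π), g (i.insertNth (α := fun _ => ℝ) t y)) :
    0 ≤ ∫ x in torusBox (n+1), g x := by
  have mp := (volume_preserving_piFinSuccAbove (fun _ : Fin (n + 1) => ℝ) i).symm
  rw [← mp.setIntegral_preimage_emb (MeasurableEquiv.measurableEmbedding _)]
  have hpre : (MeasurableEquiv.piFinSuccAbove (fun _ : Fin (n+1) => ℝ) i).symm ⁻¹' torusBox (n+1)
      = Set.Icc 0 (2 * π) ×ˢ torusBox n := by
    ext ⟨t, y⟩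
    simp only [Set.mem_preimage, torusBox, Set.mem_prod]
    exact Fin.insertNth_mem_Icc
  have hc : Continuous fun z : ℝ × (Fin n → ℝ) => g (i.insertNth (α := fun _ => ℝ) z.1 z.2) :=
    hg.comp (Continuous.finInsertNth (A := fun _ => ℝ) i continuous_fst continuous_snd)
  rw [hpre, Measure.volume_eq_prod, ← Measure.prod_restrict]
  change 0 ≤ ∫ z : ℝ × (Fin n → ℝ), g (i.insertNth (α := fun _ => ℝ) z.1 z.2) ∂_
  rw [integral_prod_symm]
  · refine integral_nonneg fun y => ?_
    have := h y
    rw [intervalIntegral.integral_of_le (by positivity), ← integral_Icc_eq_integral_Ioc] at this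
    exact this
  · rw [Measure.prod_restrict]
    exact hc.continuousOn.integrableOn_compact (isCompact_Icc.prod isCompact_Icc)

lemma aux_coord (d : ℕ) (η : (Fin d → ℝ) → ℝ)
    (hη : ContDiff ℝ (⊤ : ℕ∞) η) (hpos : ∀ x, 0 < η x)
    (hper : ∀ (x : Fin d → ℝ) (i : Fin d), η (x + Pi.single i (2 * π)) = η x) (i : Fin d) :
    0 ≤ ∫ x in torusBox d, ((pd (pd (fun y => Real.log (η y)) i) i x) ^ 2 -
      (pd (fun y => Real.log (η y)) i x) ^ 2) * η x := by
  obtain _ | n := d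
  · exact i.elim0
  have hL : ContDiff ℝ (⊤ : ℕ∞) (fun y => Real.log (η y)) := hη.log fun x => (hpos x).ne'
  set L := fun y => Real.log (η y) with hLdef
  have h1 := aux_pd_contDiff hL i
  have h2 := aux_pd_contDiff h1 i
  have c1 := h1.continuous
  have c2 := h2.continuous
  have c0 := hη.continuous
  have hpL : ∀ x, L (x + Pi.single i (2 * π)) = L x := fun x => by simp only [hLdef, hper]
  have hpd : ∀ x, pd L i (x + Pi.single i (2 * π)) = pd L i x := fun x => by
    unfold pd
    rw [← fderiv_comp_add_right]
    simp only [hpL]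
  refine aux_box i _ (by fun_prop) fun y => ?_
  have := aux_one_dim (fun t => L (i.insertNth (α := fun _ => ℝ) t y)) _ _
    (fun t => aux_pd_slice hL i y t) (fun t => aux_pd_slice h1 i y t)
    (c2.comp (Continuous.finInsertNth (A := fun _ => ℝ) i continuous_id continuous_const))
    (by rw [aux_insert, hpL]) (by rw [aux_insert, hpd])
  simpa only [hLdef, Real.exp_log (hpos _)] using this

/-- For a smooth, strictly positive function `η : ℝ^d → ℝ` which is
`2π`-periodic in each coordinate,
`∫ |∇ log η|² η ≤ ∫ Σᵢ |∂²ᵢᵢ log η|² η ≤ ∫ |D² log η|²_HS η` over `[0,2π]^d`. -/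
theorem torus_log_hessian_inequality (d : ℕ) (η : (Fin d → ℝ) → ℝ)
    (hη : ContDiff ℝ (⊤ : ℕ∞) η) (hpos : ∀ x, 0 < η x)
    (hper : ∀ (x : Fin d → ℝ) (i : Fin d), η (x + Pi.single i (2 * π)) = η x) :
    (∫ x in torusBox d, (∑ i, (pd (fun y => Real.log (η y)) i x) ^ 2) * η x) ≤
      (∫ x in torusBox d, (∑ i, (pd (pd (fun y => Real.log (η y)) i) i x) ^ 2) * η x) ∧
    (∫ x in torusBox d, (∑ i, (pd (pd (fun y => Real.log (η y)) i) i x) ^ 2) * η x) ≤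
      (∫ x in torusBox d,
        (∑ i, ∑ j, (pd (pd (fun y => Real.log (η y)) i) j x) ^ 2) * η x) := by
  have hL : ContDiff ℝ (⊤ : ℕ∞) (fun y => Real.log (η y)) := hη.log fun x => (hpos x).ne'
  have c1 := fun i => (aux_pd_contDiff hL i).continuous
  have c2 := fun i j => (aux_pd_contDiff (aux_pd_contDiff hL i) j).continuous
  have c0 := hη.continuous
  have ii (f : (Fin d → ℝ) → ℝ) (hf : Continuous f) : IntegrableOn f (torusBox d) :=
    hf.continuousOn.integrableOn_compact isCompact_Icc
  constructor
  · rw [← sub_nonneg, ← integral_sub (ii _ (by fun_prop)) (ii _ (by fun_prop))]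
    have : ∀ x, (∑ i, (pd (pd (fun y => Real.log (η y)) i) i x) ^ 2) * η x -
        (∑ i, (pd (fun y => Real.log (η y)) i x) ^ 2) * η x =
        ∑ i, ((pd (pd (fun y => Real.log (η y)) i) i x) ^ 2 -
      (pd (fun y => Real.log (η y)) i x) ^ 2) * η x := fun x => by
      rw [← sub_mul, ← Finset.sum_sub_distrib, Finset.sum_mul]
    simp only [this]
    rw [integral_finsetSum _ (fun i _ => ii _ (by fun_prop))]
    exact Finset.sum_nonneg fun i _ => aux_coord d η hη hpos hper i
  · refine integral_mono (ii _ (by fun_prop)) (ii _ (by fun_prop)) fun x => ?_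
    refine mul_le_mul_of_nonneg_right (Finset.sum_le_sum fun i _ => ?_) (hpos x).le
    exact Finset.single_le_sum (f := fun j => (pd (pd (fun y => Real.log (η y)) i) j x) ^ 2)
      (fun j _ => sq_nonneg _) (Finset.mem_univ i)
end

section
/- Let m : ℝ^d → ℝ be a twice continuously differentiable, strictly positive function, 2π-periodic in each coordinate, with ∫_{[0,2π]^d} m(x) dx = 1. Then for every k ∈ ℤ^d with k ≠ 0, ∫_{[0,2π]^d} |∇m(x)|²/m(x) dx ≥ 2|k|² [ (∫_{[0,2π]^d} cos(k·x) m(x) dx)² + (∫_{[0,2π]^d} sin(k·x) m(x) dx)² ]. -/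
open Real MeasureTheory

lemma fi_v_pos (l x : ℝ) (h0 : 0 ≤ l) (h1 : l ≤ 1) (hx : -1 ≤ x) (hx' : x ≤ 1) :
    0 < (18+l^2)*(8+9/2*l^2+l^4/2) + l*(8+l^2)*(18+l^2)*x + l^2*(18+l^2)*(2*x^2-1)
      + l^3*(4*x^3-3*x) := by
  have a1 : 0 ≤ l*(8+l^2)*(18+l^2)*(1+x) := by
    have : 0 ≤ 1 + x := by linarith
    positivity
  have a2 : 0 ≤ l^2*(18+l^2)*x^2 := by positivity
  have a3 : 0 ≤ l^3*(1+(4*x^3-3*x)) := by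
    have : 0 ≤ 1+(4*x^3-3*x) := by
      have : 1+(4*x^3-3*x) = (1+x)*(2*x-1)^2 := by ring
      rw [this]
      have : 0 ≤ 1 + x := by linarith
      positivity
    positivity
  have h3 : l^3 ≤ l^2 := by nlinarith [sq_nonneg l]
  have e : 1 ≤ 8+9/2*l^2+l^4/2 - l*(8+l^2) - l^2 := by nlinarith [sq_nonneg (l-1), sq_nonneg (l^2)]
  have f : (18+l^2)*1 ≤ (18+l^2)*(8+9/2*l^2+l^4/2 - l*(8+l^2) - l^2) := by gcongr
  have h4 : l^3 ≤ 1 := pow_le_one₀ h0 h1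
  nlinarith

lemma fi_v_ineq (l x : ℝ) (h0 : 0 ≤ l) (h1 : l ≤ 1) (hx : -1 ≤ x) (hx' : x ≤ 1) :
    -(l*(8+l^2)*(18+l^2)*x) - 4*(l^2*(18+l^2)*(2*x^2-1)) - 9*(l^3*(4*x^3-3*x)) ≤
    (l^2/2 - l*x) * ((18+l^2)*(8+9/2*l^2+l^4/2) + l*(8+l^2)*(18+l^2)*x + l^2*(18+l^2)*(2*x^2-1)
      + l^3*(4*x^3-3*x)) := by
  have key : (l^2/2 - l*x) * ((18+l^2)*(8+9/2*l^2+l^4/2) + l*(8+l^2)*(18+l^2)*x + l^2*(18+l^2)*(2*x^2-1)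
      + l^3*(4*x^3-3*x)) - (-(l*(8+l^2)*(18+l^2)*x) - 4*(l^2*(18+l^2)*(2*x^2-1)) - 9*(l^3*(4*x^3-3*x)))
      = l^4 * ((18+l^2)*(7+l^2)/4 - (4*x^4-3*x^2)) := by ring
  have h2 : x^2 ≤ 1 := by nlinarith
  have : 0 ≤ (18+l^2)*(7+l^2)/4 - (4*x^4-3*x^2) := by
    have : 4*x^4-3*x^2 ≤ 4 := by nlinarith [sq_nonneg x]
    nlinarith [sq_nonneg l, sq_nonneg (l^2)]
  have : 0 ≤ l^4 * ((18+l^2)*(7+l^2)/4 - (4*x^4-3*x^2)) := by positivity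
  linarith

lemma fi_exists_h (l : ℝ) (h0 : 0 ≤ l) (h1 : l ≤ 1) : ∃ h h' : ℝ → ℝ,
    (∀ t, HasDerivAt h (h' t) t) ∧ Continuous h' ∧ (∀ t (n : ℤ), h (t + n * (2*π)) = h t) ∧
    ∀ t, h' t + h t ^ 2 ≤ l^2/2 - l * cos t := by
  obtain ⟨c0, hc0⟩ : ∃ c, c = (18+l^2)*(8+9/2*l^2+l^4/2) := ⟨_, rfl⟩
  obtain ⟨c1, hc1⟩ : ∃ c, c = l*(8+l^2)*(18+l^2) := ⟨_, rfl⟩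
  obtain ⟨c2, hc2⟩ : ∃ c, c = l^2*(18+l^2) := ⟨_, rfl⟩
  obtain ⟨c3, hc3⟩ : ∃ c, c = l^3 := ⟨_, rfl⟩
  let v : ℝ → ℝ := fun t => c0 + c1 * cos t + c2 * cos (2*t) + c3 * cos (3*t)
  let v1 : ℝ → ℝ := fun t => - (c1 * sin t) - 2 * (c2 * sin (2*t)) - 3 * (c3 * sin (3*t))
  let v2 : ℝ → ℝ := fun t => - (c1 * cos t) - 4 * (c2 * cos (2*t)) - 9 * (c3 * cos (3*t))
  have hv : ∀ t, 0 < v t := by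
    intro t
    have := fi_v_pos l (cos t) h0 h1 (neg_one_le_cos t) (cos_le_one t)
    simp only [v, cos_two_mul, cos_three_mul, hc0, hc1, hc2, hc3]
    exact this
  have hv2 : ∀ t, v2 t ≤ (l^2/2 - l * cos t) * v t := by
    intro t
    have := fi_v_ineq l (cos t) h0 h1 (neg_one_le_cos t) (cos_le_one t)
    simp only [v, v2, cos_two_mul, cos_three_mul, hc0, hc1, hc2, hc3]
    exact this
  have lin : ∀ (a t : ℝ), HasDerivAt (fun t : ℝ => a * t) a t := fun a t => by
    simpa using (hasDerivAt_id t).const_mul a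
  have dv : ∀ t, HasDerivAt v (v1 t) t := by
    intro t
    have := ((((hasDerivAt_cos t).const_mul c1).const_add c0).add
      (((lin 2 t).cos).const_mul c2)).add (((lin 3 t).cos).const_mul c3)
    refine this.congr_deriv ?_
    simp only [v1]; ring
  have dv1 : ∀ t, HasDerivAt v1 (v2 t) t := by
    intro t
    have := ((((hasDerivAt_sin t).const_mul c1).neg).sub
      ((((lin 2 t).sin).const_mul c2).const_mul 2)).sub ((((lin 3 t).sin).const_mul c3).const_mul 3)
    refine this.congr_deriv ?_
    simp only [v2]; ring
  have cv : Continuous v := by fun_prop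
  have cv1 : Continuous v1 := by fun_prop
  have cv2 : Continuous v2 := by fun_prop
  refine ⟨fun t => v1 t / v t, fun t => (v2 t * v t - v1 t * v1 t) / v t ^ 2, ?_, ?_, ?_, ?_⟩
  · intro t
    exact (dv1 t).div (dv t) (hv t).ne'
  · exact Continuous.div (by fun_prop) (by fun_prop) (fun t => (pow_pos (hv t) 2).ne')
  · intro t n
    have e2 : 2 * (t + n * (2*π)) = 2*t + ((2*n : ℤ) : ℝ) * (2*π) := by push_cast; ring
    have e3 : 3 * (t + n * (2*π)) = 3*t + ((3*n : ℤ) : ℝ) * (2*π) := by push_cast; ring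
    simp only [v, v1, e2, e3, cos_add_int_mul_two_pi, sin_add_int_mul_two_pi]
  · intro t
    have e : (v2 t * v t - v1 t * v1 t) / v t ^ 2 + (v1 t / v t)^2 = v2 t / v t := by
      have := (hv t).ne'
      field_simp
      ring
    simp only [e]
    rw [div_le_iff₀ (hv t)]
    exact hv2 t

lemma fi_ibp (n : ℕ) (m : (Fin (n+1) → ℝ) → ℝ) (hm : ContDiff ℝ 2 m)
    (hper : ∀ (x : Fin (n+1) → ℝ) (i : Fin (n+1)), m (x + Pi.single i (2 * π)) = m x)
    (k : Fin (n+1) → ℤ) (p : ℝ) (h h' : ℝ → ℝ) (hd : ∀ t, HasDerivAt h (h' t) t)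
    (hc : Continuous h') (hp : ∀ t (n : ℤ), h (t + n * (2*π)) = h t) :
    ∫ x in torusBox (n+1), ((∑ i, (k i : ℝ)^2) * (h' (∑ i, (k i : ℝ) * x i - p) * m x) +
      h (∑ i, (k i : ℝ) * x i - p) * ∑ i, (k i : ℝ) * pd m i x) = 0 := by
  have hcont : Continuous h := continuous_iff_continuousAt.2 fun t => (hd t).continuousAt
  have hmc : Continuous m := hm.continuous
  have hfc : Continuous (fderiv ℝ m) := hm.continuous_fderiv (by norm_num)
  let L : (Fin (n+1) → ℝ) →L[ℝ] ℝ := ∑ i, (k i : ℝ) • ContinuousLinearMap.proj i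
  have hL : ∀ x, L x = ∑ i, (k i : ℝ) * x i := by intro x; simp [L]
  let f : Fin (n+1) → (Fin (n+1) → ℝ) → ℝ := fun i x => (k i : ℝ) * (h (L x - p) * m x)
  let f' : Fin (n+1) → (Fin (n+1) → ℝ) → (Fin (n+1) → ℝ) →L[ℝ] ℝ := fun i x =>
    (k i : ℝ) • (h (L x - p) • fderiv ℝ m x + m x • (h' (L x - p) • L))
  have key := integral_divergence_of_hasFDerivAt_off_countable' (E := ℝ)
    (0 : Fin (n+1) → ℝ) (fun _ => 2 * π) (fun i => by simpa using two_pi_pos.le) f f' ∅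
    Set.countable_empty
    (fun i => Continuous.continuousOn (by fun_prop))
    (fun x _ i => by
      have h1 : HasFDerivAt (fun x => L x - p) L x := L.hasFDerivAt.sub_const p
      have h2 := (hd (L x - p)).comp_hasFDerivAt x h1
      have h3 := (hm.differentiable (by norm_num) x).hasFDerivAt
      exact (h2.mul h3).const_mul (k i : ℝ))
    (Continuous.integrableOn_Icc (by fun_prop))
  have hz : ∀ i : Fin (n+1), ∀ y : Fin n → ℝ,
      f i (i.insertNth (2*π) y) = f i (i.insertNth 0 y) := by
    intro i y
    have e : (i.insertNth (2*π) y : Fin (n+1) → ℝ) =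
        (i.insertNth 0 y : Fin (n+1) → ℝ) + Pi.single i (2*π) := by
      ext j
      rcases eq_or_ne j i with rfl | hj
      · simp
      · obtain ⟨j, rfl⟩ := Fin.exists_succAbove_eq hj
        simp
    have e2 : L (Pi.single i (2*π)) = (k i : ℝ) * (2*π) := by
      rw [hL, Finset.sum_eq_single i]
      · simp
      · intro j _ hj; simp [hj]
      · simp
    simp only [f, e, hper, map_add, e2]
    rw [show L (i.insertNth 0 y) + (k i : ℝ) * (2*π) - p
      = (L (i.insertNth 0 y) - p) + (k i : ℝ) * (2*π) by ring, hp]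
  have : ∀ x, (∑ i, f' i x (Pi.single i 1)) =
      ((∑ i, (k i : ℝ)^2) * (h' (∑ i, (k i : ℝ) * x i - p) * m x) +
      h (∑ i, (k i : ℝ) * x i - p) * ∑ i, (k i : ℝ) * pd m i x) := by
    intro x
    have e2 : ∀ i, L (Pi.single i 1) = (k i : ℝ) := by
      intro i
      rw [hL, Finset.sum_eq_single i]
      · simp
      · intro j _ hj; simp [hj]
      · simp
    rw [← hL, Finset.sum_mul, Finset.mul_sum, ← Finset.sum_add_distrib]
    refine Finset.sum_congr rfl fun i _ => ?_
    simp only [f', pd, ContinuousLinearMap.smul_apply, ContinuousLinearMap.add_apply, e2,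
      smul_eq_mul]
    ring
  simp only [torusBox, ← this]
  rw [key]
  refine Finset.sum_eq_zero fun i _ => ?_
  simp only [Pi.zero_apply, hz, sub_self]

lemma fi_main (n : ℕ) (m : (Fin (n+1) → ℝ) → ℝ)
    (hm : ContDiff ℝ 2 m) (hpos : ∀ x, 0 < m x)
    (hper : ∀ (x : Fin (n+1) → ℝ) (i : Fin (n+1)), m (x + Pi.single i (2 * π)) = m x)
    (hmass : (∫ x in torusBox (n+1), m x) = 1)
    (k : Fin (n+1) → ℤ) :
    2 * (∑ i, ((k i : ℝ)) ^ 2) *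
        ((∫ x in torusBox (n+1), Real.cos (∑ i, (k i : ℝ) * x i) * m x) ^ 2 +
          (∫ x in torusBox (n+1), Real.sin (∑ i, (k i : ℝ) * x i) * m x) ^ 2) ≤
      ∫ x in torusBox (n+1), (∑ i, (pd m i x) ^ 2) / m x := by
  have hmc : Continuous m := hm.continuous
  have hfc : Continuous (fderiv ℝ m) := hm.continuous_fderiv (by norm_num)
  have hpc : ∀ i, Continuous (pd m i) := fun i => by unfold pd; fun_prop
  have hI : ∀ g : (Fin (n+1) → ℝ) → ℝ, Continuous g → IntegrableOn g (torusBox (n+1)) :=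
    fun g hg => hg.integrableOn_Icc
  obtain ⟨a, ha⟩ : ∃ a, a = ∫ x in torusBox (n+1), Real.cos (∑ i, (k i : ℝ) * x i) * m x :=
    ⟨_, rfl⟩
  obtain ⟨b, hb⟩ : ∃ b, b = ∫ x in torusBox (n+1), Real.sin (∑ i, (k i : ℝ) * x i) * m x :=
    ⟨_, rfl⟩
  rw [← ha, ← hb]
  obtain ⟨l, p, hl0, hla, hlb⟩ : ∃ l p : ℝ, 0 ≤ l ∧ l * cos p = a ∧ l * sin p = b :=
    ⟨‖(⟨a, b⟩ : ℂ)‖, Complex.arg ⟨a, b⟩, norm_nonneg _, Complex.norm_mul_cos_arg _,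
      Complex.norm_mul_sin_arg _⟩
  have hl2 : a^2 + b^2 = l^2 := by
    rw [← hla, ← hlb]; linear_combination l^2 * sin_sq_add_cos_sq p
  have hE : ∫ x in torusBox (n+1), l * cos (∑ i, (k i : ℝ) * x i - p) * m x = l^2 := by
    have : ∀ x : Fin (n+1) → ℝ, l * cos (∑ i, (k i : ℝ) * x i - p) * m x =
        a * (cos (∑ i, (k i : ℝ) * x i) * m x) + b * (sin (∑ i, (k i : ℝ) * x i) * m x) := by
      intro x; rw [cos_sub, ← hla, ← hlb]; ring
    simp only [this]
    rw [integral_add (hI _ (by fun_prop)) (hI _ (by fun_prop)), integral_const_mul,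
      integral_const_mul, ← ha, ← hb, ← hl2]
    ring
  have hl1 : l ≤ 1 := by
    have : l^2 ≤ l := by
      calc l^2 = _ := hE.symm
        _ ≤ ∫ x in torusBox (n+1), l * m x := by
          refine integral_mono (hI _ (by fun_prop)) (hI _ (by fun_prop)) fun x => ?_
          have := cos_le_one (∑ i, (k i : ℝ) * x i - p)
          have h2 : l * cos (∑ i, (k i : ℝ) * x i - p) ≤ l := by nlinarith
          exact mul_le_mul_of_nonneg_right h2 (hpos x).le
        _ = l := by rw [integral_const_mul, hmass, mul_one]
    nlinarith
  obtain ⟨h, h', hd, hc', hp, hineq⟩ := fi_exists_h l hl0 hl1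
  have hcont : Continuous h := continuous_iff_continuousAt.2 fun t => (hd t).continuousAt
  have hibp := fi_ibp n m hm hper k p h h' hd hc' hp
  rw [hl2]
  obtain ⟨K, hK⟩ : ∃ K, K = ∑ i, ((k i : ℝ)) ^ 2 := ⟨_, rfl⟩
  have hK0 : 0 ≤ K := hK ▸ Finset.sum_nonneg fun i _ => sq_nonneg _
  rw [← hK] at hibp ⊢
  have hpt : ∀ x : Fin (n+1) → ℝ,
      4 * (K * (h' (∑ i, (k i : ℝ) * x i - p) * m x) +
        h (∑ i, (k i : ℝ) * x i - p) * ∑ i, (k i : ℝ) * pd m i x) +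
      (4 * K * (l * cos (∑ i, (k i : ℝ) * x i - p) * m x) + (-(2 * K * l^2)) * m x)
      ≤ (∑ i, (pd m i x) ^ 2) / m x := by
    intro x
    rw [le_div_iff₀ (hpos x)]
    generalize (∑ i, (k i : ℝ) * x i - p) = t
    have hm0 := hpos x
    have sq : 0 ≤ ∑ i, (pd m i x - 2 * h t * k i * m x)^2 :=
      Finset.sum_nonneg fun i _ => sq_nonneg _
    have ex : ∑ i, (pd m i x - 2 * h t * k i * m x)^2 = ∑ i, (pd m i x)^2
        - 4 * h t * m x * (∑ i, (k i : ℝ) * pd m i x) + 4 * (h t)^2 * (m x)^2 * K := by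
      rw [hK, Finset.mul_sum, Finset.mul_sum, ← Finset.sum_sub_distrib, ← Finset.sum_add_distrib]
      exact Finset.sum_congr rfl fun i _ => by ring
    have q := mul_le_mul_of_nonneg_left (hineq t) (show 0 ≤ 4 * K * (m x)^2 by positivity)
    nlinarith
  calc 2 * K * l^2 = ∫ x in torusBox (n+1),
      (4 * (K * (h' (∑ i, (k i : ℝ) * x i - p) * m x) +
        h (∑ i, (k i : ℝ) * x i - p) * ∑ i, (k i : ℝ) * pd m i x) +
      (4 * K * (l * cos (∑ i, (k i : ℝ) * x i - p) * m x) + (-(2 * K * l^2)) * m x)) := by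
        rw [integral_add (hI _ (by fun_prop)) (hI _ (by fun_prop)),
          integral_add (hI _ (by fun_prop)) (hI _ (by fun_prop)), integral_const_mul,
          integral_const_mul, integral_const_mul, hibp, hE, hmass]
        ring
    _ ≤ _ := integral_mono (hI _ (by fun_prop))
        (hI _ (Continuous.div (by fun_prop) hmc fun x => (hpos x).ne')) hpt

/-- For a `C²`, strictly positive probability density `m` on the torus
`𝕋^d` and any `k ∈ ℤ^d \ {0}`, the Fisher information `I(m) = ∫ |∇m|²/m` dominates
`2|k|² q_k(m)`, where `q_k(m) = a_k(m)² + b_k(m)²` is the squared modulus of the `k`-th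
Fourier coefficient of `m`. -/
theorem fisher_information_lower_bound (d : ℕ) (m : (Fin d → ℝ) → ℝ)
    (hm : ContDiff ℝ 2 m) (hpos : ∀ x, 0 < m x)
    (hper : ∀ (x : Fin d → ℝ) (i : Fin d), m (x + Pi.single i (2 * π)) = m x)
    (hmass : (∫ x in torusBox d, m x) = 1)
    (k : Fin d → ℤ) (hk : k ≠ 0) :
    2 * (∑ i, ((k i : ℝ)) ^ 2) *
        ((∫ x in torusBox d, Real.cos (∑ i, (k i : ℝ) * x i) * m x) ^ 2 +
          (∫ x in torusBox d, Real.sin (∑ i, (k i : ℝ) * x i) * m x) ^ 2) ≤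
      ∫ x in torusBox d, (∑ i, (pd m i x) ^ 2) / m x := by
  cases d with
  | zero => exact absurd (Subsingleton.elim k 0) hk
  | succ n => exact fi_main n m hm hpos hper hmass k
end

section
/- Fix k ∈ ℤ^d with k ≠ 0. Then the supremum of 2|k|² q_k(m) / I(m), taken over all twice continuously differentiable strictly positive probability densities m on the torus 𝕋^d that are not identically equal to (2π)^{-d}, equals 1. -/
open Real MeasureTheory

lemma int_pd {d : ℕ} (F : (Fin d → ℝ) → ℝ) (hF : ContDiff ℝ 1 F)
    (per : ∀ (x : Fin d → ℝ) (i : Fin d), F (x + Pi.single i (2 * π)) = F x) (i : Fin d) :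
    ∫ x in torusBox d, pd F i x = 0 := by
  obtain _ | n := d
  · exact i.elim0
  have hpd : Continuous (pd F i) := by
    unfold pd
    exact (hF.continuous_fderiv (by norm_num)).clm_apply continuous_const
  have hle : (0 : Fin (n+1) → ℝ) ≤ (fun _ => 2 * π) := fun _ => by positivity
  have hs : ∀ x, (∑ j, (if j = i then fderiv ℝ F x else 0) (Pi.single j 1)) = pd F i x := by
    intro x
    rw [Finset.sum_eq_single i]
    · simp [pd]
    · intro j _ hj; simp [hj]
    · simp
  have := integral_divergence_of_hasFDerivAt_off_countable' (0 : Fin (n+1) → ℝ) (fun _ => 2 * π)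
    hle (fun j x => if j = i then F x else 0) (fun j x => if j = i then fderiv ℝ F x else 0) ∅
    Set.countable_empty
    (fun j => by
      by_cases h : j = i
      · simpa [h] using hF.continuous.continuousOn
      · simpa [h] using continuousOn_const)
    (fun x _ j => by
      by_cases h : j = i
      · simpa [h] using (hF.differentiable (by norm_num) x).hasFDerivAt
      · simpa [h] using hasFDerivAt_const (0:ℝ) x)
    (by
      simp only [hs]
      exact hpd.continuousOn.integrableOn_compact isCompact_Icc)
  simp only [hs] at this
  rw [torusBox, this]
  apply Finset.sum_eq_zero
  intro j _
  by_cases h : j = i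
  · subst h
    simp only [if_true]
    rw [sub_eq_zero]
    congr 1
    ext y
    rw [← per (j.insertNth ((0 : Fin (n+1) → ℝ) j) y) j]
    congr 1
    ext l
    refine Fin.succAboveCases j ?_ ?_ l
    · simp
    · intro l; simp
  · simp [h]

/-- calculus facts for compositions with the phase -/
lemma phase_hasFDerivAt {d : ℕ} (k : Fin d → ℤ) (φ : ℝ) (x : Fin d → ℝ) :
    HasFDerivAt (fun x : Fin d → ℝ => (∑ i, (k i : ℝ) * x i) - φ)
      (∑ i, (k i : ℝ) • (ContinuousLinearMap.proj i : (Fin d → ℝ) →L[ℝ] ℝ)) x := by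
  apply HasFDerivAt.sub_const
  apply HasFDerivAt.fun_sum
  intro i _
  exact (hasFDerivAt_apply i x).const_mul _

lemma phase_apply {d : ℕ} (k : Fin d → ℤ) (i : Fin d) :
    (∑ i, (k i : ℝ) • (ContinuousLinearMap.proj i : (Fin d → ℝ) →L[ℝ] ℝ)) (Pi.single i 1)
      = k i := by
  simp [Pi.single_apply]

lemma phase_per {d : ℕ} (k : Fin d → ℤ) (φ : ℝ) (x : Fin d → ℝ) (i : Fin d) :
    (∑ j, (k j : ℝ) * (x + Pi.single i (2 * π) : Fin d → ℝ) j) - φ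
      = ((∑ j, (k j : ℝ) * x j) - φ) + k i * (2 * π) := by
  simp [mul_add, Finset.sum_add_distrib, Pi.single_apply]
  ring

lemma pd_comp_mul {d : ℕ} (k : Fin d → ℤ) (φ : ℝ) (G : ℝ → ℝ) (m : (Fin d → ℝ) → ℝ)
    (x : Fin d → ℝ) (G' : ℝ) (hG : HasDerivAt G G' ((∑ i, (k i : ℝ) * x i) - φ))
    (hm : DifferentiableAt ℝ m x) (i : Fin d) :
    pd (fun x => G ((∑ i, (k i : ℝ) * x i) - φ) * m x) i x
      = k i * G' * m x + G ((∑ i, (k i : ℝ) * x i) - φ) * pd m i x := by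
  have h1 := (hG.comp_hasFDerivAt x (phase_hasFDerivAt k φ x)).mul hm.hasFDerivAt
  unfold pd
  have h2 : (fun x => G ((∑ i, (k i : ℝ) * x i) - φ) * m x) = 
    (G ∘ (fun x : Fin d → ℝ => (∑ i, (k i : ℝ) * x i) - φ)) * m := rfl
  rw [h2, h1.fderiv]
  simp [Pi.single_apply]
  ring

lemma int_by_parts {d : ℕ} (k : Fin d → ℤ) (φ : ℝ) (G G' : ℝ → ℝ) (m : (Fin d → ℝ) → ℝ)
    (hG : ∀ t, HasDerivAt G (G' t) t) (hG1 : ContDiff ℝ 1 G)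
    (hper : Function.Periodic G (2 * π)) (hm : ContDiff ℝ 1 m)
    (per : ∀ (x : Fin d → ℝ) (i : Fin d), m (x + Pi.single i (2 * π)) = m x) (i : Fin d) :
    ∫ x in torusBox d, (k i * G' ((∑ i, (k i : ℝ) * x i) - φ) * m x
      + G ((∑ i, (k i : ℝ) * x i) - φ) * pd m i x) = 0 := by
  have := int_pd (fun x => G ((∑ i, (k i : ℝ) * x i) - φ) * m x)
    ((hG1.comp (by fun_prop)).mul hm) (fun x j => by
      simp only [per]
      rw [phase_per]
      have := (hper.int_mul (k j)) ((∑ j, (k j : ℝ) * x j) - φ)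
      rw [this]) i
  rw [← this]
  congr 1
  ext x
  rw [pd_comp_mul k φ G m x _ (hG _) (hm.differentiable (by norm_num) x)]

noncomputable def hfun (a t : ℝ) : ℝ :=
  a * sin t * (1 - a * cos t / 2 - a ^ 2 * (1 - cos t ^ 2) * (1 / 3 - a * cos t / 10))

noncomputable def hfun' (a t : ℝ) : ℝ :=
  a * cos t * (1 - a * cos t / 2 - a ^ 2 * (1 - cos t ^ 2) * (1 / 3 - a * cos t / 10))
  + a * sin t ^ 2 * (a / 2 * (-1) * (-1) 
     + a ^ 2 * (-2 * cos t) * (1 / 3 - a * cos t / 10) + a ^ 2 * (1 - cos t ^ 2) * (- a / 10))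

lemma hfun_deriv (a t : ℝ) : HasDerivAt (hfun a) (hfun' a t) t := by
  have hc := hasDerivAt_cos t
  have hs := hasDerivAt_sin t
  have h := (hs.const_mul a).mul ((((hc.const_mul a).div_const 2).const_sub 1).sub
    ((((hc.pow 2).const_sub 1).const_mul (a^2)).mul (((hc.const_mul a).div_const 10).const_sub (1/3))))
  refine h.congr_deriv ?_
  simp [hfun']
  ring

lemma hfun_ineq (a t : ℝ) (ha : 0 ≤ a) (ha1 : a ≤ 1) :
    a * cos t - a ^ 2 / 2 ≤ hfun' a t - hfun a t ^ 2 := by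
  have hs : sin t ^ 2 = 1 - cos t ^ 2 := by rw [sin_sq]
  have hc1 := neg_one_le_cos t
  have hc2 := cos_le_one t
  set c := cos t with hc
  set y := 1 / 3 - a * c / 10 with hy
  have key : hfun' a t - hfun a t ^ 2 - (a * c - a ^ 2 / 2) =
     a ^ 2 * (1 - c ^ 2) * (a ^ 2 * (c ^ 2 / 20 + (1 - c ^ 2) *
       (2 * y - 1 / 10 - a * c * y - (1 - c ^ 2) * a ^ 2 * y ^ 2))) := by
    simp only [hfun, hfun', mul_pow, hs, ← hc, hy]
    ring
  have hx1 : a * c ≤ 1 := by nlinarith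
  have hx2 : -1 ≤ a * c := by nlinarith
  have ht : 0 ≤ 1 - c ^ 2 := by nlinarith
  have hb : (1 - c ^ 2) * a ^ 2 ≤ 1 := by nlinarith [sq_nonneg c, sq_nonneg (a * c)]
  have h1 : (1 - c ^ 2) * a ^ 2 * y ^ 2 ≤ 1 * y ^ 2 := by gcongr
  have h2 : 0 ≤ 2 * y - 1 / 10 - a * c * y - 1 * y ^ 2 := by
    rw [hy]; nlinarith
  have : 0 ≤ 2 * y - 1 / 10 - a * c * y - (1 - c ^ 2) * a ^ 2 * y ^ 2 := by linarith
  have : 0 ≤ hfun' a t - hfun a t ^ 2 - (a * c - a ^ 2 / 2) := by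
    rw [key]; positivity
  linarith

lemma cont_int {d : ℕ} {f : (Fin d → ℝ) → ℝ} (hf : Continuous f) :
    Integrable f (volume.restrict (torusBox d)) :=
  hf.continuousOn.integrableOn_compact isCompact_Icc

lemma hfun_per (a : ℝ) : Function.Periodic (hfun a) (2 * π) := by
  intro t; simp [hfun]

lemma hfun_contDiff (a : ℝ) : ContDiff ℝ 1 (hfun a) := by
  unfold hfun; fun_prop

lemma pd_cont {d : ℕ} {m : (Fin d → ℝ) → ℝ} (hm : ContDiff ℝ 1 m) (i : Fin d) :
    Continuous (pd m i) := by
  unfold pd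
  exact (hm.continuous_fderiv (by norm_num)).clm_apply continuous_const

lemma upper {d : ℕ} (k : Fin d → ℤ) (m : (Fin d → ℝ) → ℝ) (hm : ContDiff ℝ 1 m)
    (pos : ∀ x, 0 < m x)
    (per : ∀ (x : Fin d → ℝ) (i : Fin d), m (x + Pi.single i (2 * π)) = m x)
    (h1 : (∫ x in torusBox d, m x) = 1) :
    2 * (∑ i, ((k i : ℝ)) ^ 2) *
                ((∫ x in torusBox d, Real.cos (∑ i, (k i : ℝ) * x i) * m x) ^ 2 +
                  (∫ x in torusBox d, Real.sin (∑ i, (k i : ℝ) * x i) * m x) ^ 2) ≤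
              (∫ x in torusBox d, (∑ i, (pd m i x) ^ 2) / m x) := by
  have hmc := hm.continuous
  set A := ∫ x in torusBox d, Real.cos (∑ i, (k i : ℝ) * x i) * m x with hA
  set B := ∫ x in torusBox d, Real.sin (∑ i, (k i : ℝ) * x i) * m x with hB
  set r := ‖(⟨A, B⟩ : ℂ)‖ with hr
  set φ := Complex.arg (⟨A, B⟩ : ℂ) with hφ
  have hAr : A = r * cos φ := (Complex.norm_mul_cos_arg (⟨A, B⟩ : ℂ)).symm
  have hBr : B = r * sin φ := (Complex.norm_mul_sin_arg (⟨A, B⟩ : ℂ)).symm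
  have hr0 : 0 ≤ r := norm_nonneg _
  have hAB : A ^ 2 + B ^ 2 = r ^ 2 := by
    rw [hAr, hBr]; linear_combination r ^ 2 * (sin_sq_add_cos_sq φ)
  have hcosr : ∫ x in torusBox d, cos ((∑ i, (k i : ℝ) * x i) - φ) * m x = r := by
    have : ∀ x : Fin d → ℝ, cos ((∑ i, (k i : ℝ) * x i) - φ) * m x =
      cos φ * (cos (∑ i, (k i : ℝ) * x i) * m x) + sin φ * (sin (∑ i, (k i : ℝ) * x i) * m x) := by
      intro x; rw [cos_sub]; ring
    simp only [this]
    rw [integral_add (cont_int (by fun_prop)) (cont_int (by fun_prop)), integral_const_mul,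
      integral_const_mul, ← hA, ← hB, hAr, hBr]
    linear_combination r * (sin_sq_add_cos_sq φ)
  have hr1 : r ≤ 1 := by
    rw [← hcosr, ← h1]
    apply integral_mono (cont_int (by fun_prop)) (cont_int hmc)
    intro x
    have := cos_le_one ((∑ i, (k i : ℝ) * x i) - φ)
    have := pos x
    simp only
    nlinarith
  have hh := (hfun_contDiff r).continuous
  have hh' : Continuous (hfun' r) := by unfold hfun'; fun_prop
  have hpd := fun i => pd_cont hm i
  have hibp : ∫ x in torusBox d, (∑ i, (k i : ℝ) * (k i * hfun' r ((∑ i, (k i : ℝ) * x i) - φ) * m x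
      + hfun r ((∑ i, (k i : ℝ) * x i) - φ) * pd m i x)) = 0 := by
    rw [integral_finsetSum]
    · apply Finset.sum_eq_zero
      intro i _
      rw [integral_const_mul, int_by_parts k φ (hfun r) (hfun' r) m (hfun_deriv r)
        (hfun_contDiff r) (hfun_per r) hm per i, mul_zero]
    · intro i _
      have := hpd i
      exact cont_int (by fun_prop)
  have hpt : ∀ x, 4 * (∑ i, ((k i : ℝ)) ^ 2) *
      (r * (cos ((∑ i, (k i : ℝ) * x i) - φ) * m x) - r ^ 2 / 2 * m x)
       - 4 * (∑ i, (k i : ℝ) * (k i * hfun' r ((∑ i, (k i : ℝ) * x i) - φ) * m x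
      + hfun r ((∑ i, (k i : ℝ) * x i) - φ) * pd m i x)) ≤ (∑ i, (pd m i x) ^ 2) / m x := by
    intro x
    have hi := hfun_ineq r ((∑ i, (k i : ℝ) * x i) - φ) hr0 hr1
    set t := (∑ i, (k i : ℝ) * x i) - φ
    have hp := pos x
    have e1 : (∑ i, ((k i : ℝ)) ^ 2) *
      (r * (cos t * m x) - r ^ 2 / 2 * m x) ≤ (∑ i, ((k i : ℝ)) ^ 2) *
       ((hfun' r t - hfun r t ^ 2) * m x) := by
      apply mul_le_mul_of_nonneg_left _ (Finset.sum_nonneg fun i _ => sq_nonneg _)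
      nlinarith
    have e2 : 4 * ((∑ i, ((k i : ℝ)) ^ 2) * ((hfun' r t - hfun r t ^ 2) * m x))
       - 4 * (∑ i, (k i : ℝ) * (k i * hfun' r t * m x
      + hfun r t * pd m i x)) ≤ (∑ i, (pd m i x) ^ 2) / m x := by
      rw [Finset.sum_mul, Finset.mul_sum, Finset.mul_sum, ← Finset.sum_sub_distrib, Finset.sum_div]
      apply Finset.sum_le_sum
      intro i _
      rw [le_div_iff₀ hp]
      nlinarith [sq_nonneg (pd m i x + 2 * hfun r t * k i * m x)]
    linarith
  have hcs : Continuous fun x => (∑ i, (pd m i x) ^ 2) / m x :=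
    Continuous.div (by fun_prop) hmc (fun x => (pos x).ne')
  have hmono := integral_mono (μ := volume.restrict (torusBox d)) (cont_int (by fun_prop))
    (cont_int hcs) hpt
  rw [integral_sub (cont_int (by fun_prop)) (cont_int (by fun_prop)), integral_const_mul,
    integral_const_mul, hibp, integral_sub (cont_int (by fun_prop)) (cont_int (by fun_prop)),
    integral_const_mul, integral_const_mul, hcosr, h1] at hmono
  rw [hAB]
  linarith

lemma int_trig {d : ℕ} (k : Fin d → ℤ) (hk : k ≠ 0) (G G' : ℝ → ℝ)
    (hG : ∀ t, HasDerivAt G (G' t) t) (hG1 : ContDiff ℝ 1 G)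
    (hper : Function.Periodic G (2 * π)) :
    ∫ x in torusBox d, G' (∑ i, (k i : ℝ) * x i) = 0 := by
  obtain ⟨i, hi⟩ := Function.ne_iff.1 hk
  have := int_by_parts k 0 G G' (fun _ => 1) hG hG1 hper contDiff_const (fun _ _ => rfl) i
  simp only [pd, sub_zero, mul_one] at this
  simp only [fderiv_const_apply, zero_apply, mul_zero, add_zero] at this
  rw [integral_const_mul] at this
  rcases mul_eq_zero.1 this with h | h
  · exact absurd (by exact_mod_cast h) hi
  · exact h

lemma vol_box (d : ℕ) : ∫ _x in torusBox d, (1 : ℝ) = (2 * π) ^ d := by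
  simp [torusBox, Measure.real, Real.volume_Icc_pi, ENNReal.toReal_ofReal, pi_pos.le]

theorem fisher_information_ratio_sup (d : ℕ) (k : Fin d → ℤ) (hk : k ≠ 0) :
    IsLUB
      { r : ℝ | ∃ m : (Fin d → ℝ) → ℝ, ContDiff ℝ 2 m ∧ (∀ x, 0 < m x) ∧
          (∀ (x : Fin d → ℝ) (i : Fin d), m (x + Pi.single i (2 * π)) = m x) ∧
          (∫ x in torusBox d, m x) = 1 ∧
          m ≠ (fun _ => ((2 * π) ^ d)⁻¹) ∧
          r = 2 * (∑ i, ((k i : ℝ)) ^ 2) *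
                ((∫ x in torusBox d, Real.cos (∑ i, (k i : ℝ) * x i) * m x) ^ 2 +
                  (∫ x in torusBox d, Real.sin (∑ i, (k i : ℝ) * x i) * m x) ^ 2) /
              (∫ x in torusBox d, (∑ i, (pd m i x) ^ 2) / m x) }
      1 := by
  constructor
  · rintro r ⟨m, hm, pos, per, h1, -, rfl⟩
    apply div_le_one_of_le₀ (upper k m (hm.of_le (by norm_num)) pos per h1)
    exact integral_nonneg fun x => div_nonneg (Finset.sum_nonneg fun i _ => sq_nonneg _) (pos x).le
  · intro b hb
    set K := ∑ i, ((k i : ℝ)) ^ 2 with hK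
    have hKpos : 0 < K := by
      obtain ⟨i, hi⟩ := Function.ne_iff.1 hk
      refine Finset.sum_pos' (fun i _ => sq_nonneg _) ⟨i, Finset.mem_univ _, ?_⟩
      have : (k i : ℝ) ≠ 0 := by exact_mod_cast hi
      positivity
    set V := (2 * π) ^ d with hV
    have hVpos : 0 < V := by positivity
    have hvol := vol_box d
    rw [← hV] at hvol
    have i1 : ∫ x in torusBox d, cos (∑ i, (k i : ℝ) * x i) = 0 :=
      int_trig k hk sin cos hasDerivAt_sin contDiff_sin sin_periodic
    have i2 : ∫ x in torusBox d, (2 * cos (∑ i, (k i : ℝ) * x i) ^ 2 - 1) = 0 := by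
      refine int_trig k hk (fun t => sin t * cos t) (fun t => 2 * cos t ^ 2 - 1) ?_
        (by fun_prop) ?_
      · intro t
        refine ((hasDerivAt_sin t).mul (hasDerivAt_cos t)).congr_deriv ?_
        linear_combination - (sin_sq_add_cos_sq t)
      · intro t; simp
    have i3 : ∫ x in torusBox d, cos (∑ i, (k i : ℝ) * x i) ^ 2 = V / 2 := by
      rw [integral_sub (cont_int (by fun_prop)) (cont_int (by fun_prop)), integral_const_mul,
        hvol] at i2
      linarith
    have i4 : ∫ x in torusBox d, sin (∑ i, (k i : ℝ) * x i) ^ 2 = V / 2 := by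
      simp only [sin_sq]
      rw [integral_sub (cont_int (by fun_prop)) (cont_int (by fun_prop)), i3, hvol]
      ring
    have main : ∀ ε : ℝ, 0 < ε → ε < 1 → 1 - ε ≤ b := by
      intro ε h0 h1
      set m : (Fin d → ℝ) → ℝ := fun x => V⁻¹ * (1 + ε * cos (∑ i, (k i : ℝ) * x i)) with hm
      have hlo : ∀ x : Fin d → ℝ, 1 - ε ≤ 1 + ε * cos (∑ i, (k i : ℝ) * x i) := fun x => by
        nlinarith [neg_one_le_cos (∑ i, (k i : ℝ) * x i)]
      have hhi : ∀ x : Fin d → ℝ, 1 + ε * cos (∑ i, (k i : ℝ) * x i) ≤ 1 + ε := fun x => by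
        nlinarith [cos_le_one (∑ i, (k i : ℝ) * x i)]
      have hpos : ∀ x, 0 < m x := fun x => mul_pos (inv_pos.2 hVpos) (by linarith [hlo x])
      have hmC : ContDiff ℝ 2 m := by rw [hm]; fun_prop
      have hpdm : ∀ i x, pd m i x = - V⁻¹ * ε * k i * sin (∑ i, (k i : ℝ) * x i) := by
        intro i x
        have := pd_comp_mul k 0 (fun t => V⁻¹ * (1 + ε * cos t)) (fun _ => 1) x _
          ((((hasDerivAt_cos _).const_mul ε).const_add 1).const_mul V⁻¹)
          (differentiableAt_const _) i
        simp only [sub_zero, mul_one] at this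
        rw [hm, this]
        simp [pd]
        ring
      have hper : ∀ (x : Fin d → ℝ) (i : Fin d), m (x + Pi.single i (2 * π)) = m x := by
        intro x i
        have := phase_per k 0 x i
        simp only [sub_zero] at this
        simp only [hm, this, cos_add_int_mul_two_pi]
      have hint : ∫ x in torusBox d, m x = 1 := by
        rw [hm, integral_const_mul, integral_add (cont_int (by fun_prop)) (cont_int (by fun_prop)),
          integral_const_mul, i1, hvol]
        field_simp
        ring
      have hne : m ≠ fun _ => V⁻¹ := by
        intro h
        have := congrFun h 0
        simp only [hm, Pi.zero_apply, mul_zero, Finset.sum_const_zero, cos_zero, mul_one] at this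
        have hv : 0 < V⁻¹ := inv_pos.2 hVpos
        nlinarith
      have hA : ∫ x in torusBox d, Real.cos (∑ i, (k i : ℝ) * x i) * m x = ε / 2 := by
        have : ∀ x : Fin d → ℝ, cos (∑ i, (k i : ℝ) * x i) * m x =
            V⁻¹ * (cos (∑ i, (k i : ℝ) * x i) + ε * cos (∑ i, (k i : ℝ) * x i) ^ 2) := by
          intro x; simp only [hm]; ring
        simp only [this]
        rw [integral_const_mul, integral_add (cont_int (by fun_prop)) (cont_int (by fun_prop)),
          integral_const_mul, i1, i3]
        field_simp
        ring
      have hsum : ∀ x : Fin d → ℝ, (∑ i, (pd m i x) ^ 2) / m x =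
          V⁻¹ * ε ^ 2 * K * (sin (∑ i, (k i : ℝ) * x i) ^ 2 /
            (1 + ε * cos (∑ i, (k i : ℝ) * x i))) := by
        intro x
        have h2 : 0 < 1 + ε * cos (∑ i, (k i : ℝ) * x i) := by linarith [hlo x]
        have h3 : (∑ i, (pd m i x) ^ 2) =
            V⁻¹ ^ 2 * ε ^ 2 * sin (∑ i, (k i : ℝ) * x i) ^ 2 * K := by
          rw [hK, Finset.mul_sum]
          refine Finset.sum_congr rfl fun i _ => ?_
          rw [hpdm]; ring
        rw [h3]
        simp only [hm]
        field_simp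
      have hcont : Continuous fun x : Fin d → ℝ => sin (∑ i, (k i : ℝ) * x i) ^ 2 /
            (1 + ε * cos (∑ i, (k i : ℝ) * x i)) :=
        Continuous.div (by fun_prop) (by fun_prop) (fun x => by linarith [hlo x])
      set J := ∫ x in torusBox d, sin (∑ i, (k i : ℝ) * x i) ^ 2 /
            (1 + ε * cos (∑ i, (k i : ℝ) * x i)) with hJ
      have hJ1 : J ≤ V / 2 / (1 - ε) := by
        rw [← i4, ← integral_div]
        refine integral_mono (cont_int hcont) (cont_int (by fun_prop)) fun x => ?_
        exact div_le_div_of_nonneg_left (sq_nonneg _) (by linarith) (hlo x)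
      have hJ2 : V / 2 / (1 + ε) ≤ J := by
        rw [← i4, ← integral_div]
        refine integral_mono (cont_int (by fun_prop)) (cont_int hcont) fun x => ?_
        exact div_le_div_of_nonneg_left (sq_nonneg _) (by linarith [hlo x]) (hhi x)
      have hJ0 : 0 < J := lt_of_lt_of_le (by positivity) hJ2
      refine le_trans ?_ (hb ⟨m, hmC, hpos, hper, hint, hne, rfl⟩)
      simp only [hsum]
      rw [integral_const_mul, ← hJ, hA, le_div_iff₀ (by positivity)]
      have h5 : (1 - ε) * J ≤ V / 2 := by
        rwa [le_div_iff₀ (by linarith), mul_comm] at hJ1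
      calc (1 - ε) * (V⁻¹ * ε ^ 2 * K * J) = V⁻¹ * ε ^ 2 * K * ((1 - ε) * J) := by ring
        _ ≤ V⁻¹ * ε ^ 2 * K * (V / 2) := by gcongr
        _ = 2 * K * ((ε / 2) ^ 2 + 0) := by field_simp; ring
        _ ≤ _ := by gcongr; positivity
    by_contra hlt
    push Not at hlt
    have := main (min (1/2) ((1 - b) / 2)) (by apply lt_min <;> linarith)
      (lt_of_le_of_lt (min_le_left _ _) (by norm_num))
    have := min_le_right (1/2) ((1 - b) / 2)
    linarith
end

section
/- Fix k ∈ ℤ^d with k ≠ 0 and ε ∈ (0,1/4), and define m_ε(x) = (2π)^{-d}(1 + 2ε cos(k·x)). Then m_ε is a strictly positive probability density on 𝕋^d; its Fourier coefficient satisfies q_k(m_ε) = ε²; its Fisher information equals I(m_ε) = (4ε²|k|²/(2π)^d) ∫_{[0,2π]^d} sin²(k·x)/(1 + 2ε cos(k·x)) dx; and I(m_ε)/(2|k|²ε²) → 1 as ε ↓ 0. -/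
open Real MeasureTheory Filter

/-- The perturbed density `m_ε(x) = (2π)^{-d} (1 + 2ε cos(k·x))`. -/
noncomputable def mEps (d : ℕ) (k : Fin d → ℤ) (ε : ℝ) (x : Fin d → ℝ) : ℝ :=
  ((2 * π) ^ d)⁻¹ * (1 + 2 * ε * Real.cos (∑ i, (k i : ℝ) * x i))

lemma aux_box_s4 (d : ℕ) : (volume : Measure (Fin d → ℝ)).restrict (torusBox d) =
    Measure.pi (fun _ : Fin d => (volume : Measure ℝ).restrict (Set.Icc 0 (2 * π))) := by
  rw [← Measure.restrict_pi_pi, torusBox, ← Set.pi_univ_Icc]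
  rfl

lemma aux_one (n : ℤ) (hn : n ≠ 0) :
    ∫ t in Set.Icc (0:ℝ) (2 * π), Complex.exp (Complex.I * ((n : ℝ) * t : ℝ)) = 0 := by
  rw [integral_Icc_eq_integral_Ioc, ← intervalIntegral.integral_of_le (by positivity)]
  have hc : (Complex.I * n : ℂ) ≠ 0 := mul_ne_zero Complex.I_ne_zero (by exact_mod_cast hn)
  have := integral_exp_mul_complex (a := 0) (b := 2 * π) hc
  have e : ∀ t : ℝ, Complex.I * ((n : ℝ) * t : ℝ) = Complex.I * n * t := by
    intro t; push_cast; ring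
  simp_rw [e]
  rw [this]
  have h2 : Complex.I * n * ((2 * π : ℝ) : ℂ) = n * (2 * π * Complex.I) := by
    push_cast; ring
  rw [h2, Complex.exp_int_mul_two_pi_mul_I]
  simp

lemma aux_exp (d : ℕ) (k : Fin d → ℤ) (hk : k ≠ 0) :
    ∫ x in torusBox d, Complex.exp (Complex.I * ((∑ i, (k i : ℝ) * x i : ℝ) : ℂ)) = 0 := by
  have e : ∀ x : Fin d → ℝ, Complex.exp (Complex.I * ((∑ i, (k i : ℝ) * x i : ℝ) : ℂ)) =
      ∏ i, Complex.exp (Complex.I * ((k i : ℝ) * x i : ℝ)) := by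
    intro x
    rw [← Complex.exp_sum, Complex.ofReal_sum, Finset.mul_sum]
  simp_rw [e]
  rw [aux_box_s4]
  rw [integral_fintype_prod_eq_prod (𝕜 := ℂ)
    (f := fun i (t : ℝ) => Complex.exp (Complex.I * ((k i : ℝ) * t : ℝ)))]
  obtain ⟨i, hi⟩ := Function.ne_iff.mp hk
  exact Finset.prod_eq_zero (Finset.mem_univ i) (aux_one _ hi)

lemma aux_compact (d : ℕ) : IsCompact (torusBox d) := isCompact_Icc

lemma aux_int {E : Type*} [NormedAddCommGroup E] (d : ℕ) (f : (Fin d → ℝ) → E)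
    (hf : Continuous f) : IntegrableOn f (torusBox d) :=
  hf.continuousOn.integrableOn_compact (aux_compact d)

lemma aux_cos (d : ℕ) (k : Fin d → ℤ) (hk : k ≠ 0) :
    ∫ x in torusBox d, Real.cos (∑ i, (k i : ℝ) * x i) = 0 := by
  have h := aux_exp d k hk
  have h2 := integral_re (𝕜 := ℂ) (aux_int d
    (fun x : Fin d → ℝ => Complex.exp (Complex.I * ((∑ i, (k i : ℝ) * x i : ℝ) : ℂ)))
    (by fun_prop))
  rw [h] at h2
  rw [← map_zero (RCLike.re (K := ℂ)), ← h2]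
  congr 1; ext x
  rw [mul_comm Complex.I]
  exact (Complex.exp_ofReal_mul_I_re _).symm

lemma aux_sin (d : ℕ) (k : Fin d → ℤ) (hk : k ≠ 0) :
    ∫ x in torusBox d, Real.sin (∑ i, (k i : ℝ) * x i) = 0 := by
  have h := aux_exp d k hk
  have h2 := integral_im (𝕜 := ℂ) (aux_int d
    (fun x : Fin d → ℝ => Complex.exp (Complex.I * ((∑ i, (k i : ℝ) * x i : ℝ) : ℂ)))
    (by fun_prop))
  rw [h] at h2
  rw [← map_zero (RCLike.im (K := ℂ)), ← h2]
  congr 1; ext x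
  rw [mul_comm Complex.I]
  exact (Complex.exp_ofReal_mul_I_im _).symm

lemma aux_const (d : ℕ) (c : ℝ) : ∫ _x in torusBox d, c = (2 * π) ^ d * c := by
  rw [setIntegral_const, smul_eq_mul]
  congr 1
  rw [torusBox, Measure.real, Real.volume_Icc_pi_toReal]
  · simp
  · intro i; simp only [Pi.zero_apply]; positivity

lemma aux_two (d : ℕ) (k : Fin d → ℤ) (x : Fin d → ℝ) :
    ∑ i, (((fun i => 2 * k i) i : ℤ) : ℝ) * x i = 2 * ∑ i, (k i : ℝ) * x i := by
  rw [Finset.mul_sum]; congr 1; ext i; push_cast; ring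

lemma aux_two_ne (d : ℕ) (k : Fin d → ℤ) (hk : k ≠ 0) : (fun i => 2 * k i) ≠ 0 := by
  obtain ⟨i, hi⟩ := Function.ne_iff.mp hk
  intro h
  have := congrFun h i
  simp at this hi
  exact hi this

lemma aux_cos2 (d : ℕ) (k : Fin d → ℤ) (hk : k ≠ 0) :
    ∫ x in torusBox d, Real.cos (2 * ∑ i, (k i : ℝ) * x i) = 0 := by
  have := aux_cos d _ (aux_two_ne d k hk)
  simp_rw [aux_two] at this
  exact this

lemma aux_sin2 (d : ℕ) (k : Fin d → ℤ) (hk : k ≠ 0) :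
    ∫ x in torusBox d, Real.sin (2 * ∑ i, (k i : ℝ) * x i) = 0 := by
  have := aux_sin d _ (aux_two_ne d k hk)
  simp_rw [aux_two] at this
  exact this

lemma aux_sinsq (d : ℕ) (k : Fin d → ℤ) (hk : k ≠ 0) :
    ∫ x in torusBox d, Real.sin (∑ i, (k i : ℝ) * x i) ^ 2 = (2 * π) ^ d * (1 / 2) := by
  simp_rw [Real.sin_sq_eq_half_sub]
  rw [integral_sub (aux_int d _ (by fun_prop)) (aux_int d _ (by fun_prop)), aux_const,
    integral_div, aux_cos2 d k hk]
  ring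

lemma aux_mass (d : ℕ) (k : Fin d → ℤ) (hk : k ≠ 0) (ε : ℝ) :
    ∫ x in torusBox d, mEps d k ε x = 1 := by
  have hp : (2 * π) ^ d ≠ 0 := by positivity
  simp only [mEps]
  rw [integral_const_mul, integral_add (aux_int d _ (by fun_prop)) (aux_int d _ (by fun_prop)),
    aux_const, integral_const_mul, aux_cos d k hk]
  field_simp
  ring

lemma aux_qc (d : ℕ) (k : Fin d → ℤ) (hk : k ≠ 0) (ε : ℝ) :
    ∫ x in torusBox d, Real.cos (∑ i, (k i : ℝ) * x i) * mEps d k ε x = ε := by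
  have hp : (2 * π) ^ d ≠ 0 := by positivity
  have e : ∀ x : Fin d → ℝ, Real.cos (∑ i, (k i : ℝ) * x i) * mEps d k ε x =
      ((2 * π) ^ d)⁻¹ * (Real.cos (∑ i, (k i : ℝ) * x i) +
        (ε + ε * Real.cos (2 * ∑ i, (k i : ℝ) * x i))) := by
    intro x
    rw [mEps, Real.cos_two_mul]; ring
  simp_rw [e]
  rw [integral_const_mul, integral_add (aux_int d _ (by fun_prop)) (aux_int d _ (by fun_prop)),
    integral_add (aux_int d _ (by fun_prop)) (aux_int d _ (by fun_prop)),
    aux_const, integral_const_mul, aux_cos d k hk, aux_cos2 d k hk]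
  field_simp
  ring

lemma aux_qs (d : ℕ) (k : Fin d → ℤ) (hk : k ≠ 0) (ε : ℝ) :
    ∫ x in torusBox d, Real.sin (∑ i, (k i : ℝ) * x i) * mEps d k ε x = 0 := by
  have e : ∀ x : Fin d → ℝ, Real.sin (∑ i, (k i : ℝ) * x i) * mEps d k ε x =
      ((2 * π) ^ d)⁻¹ * (Real.sin (∑ i, (k i : ℝ) * x i) +
        ε * Real.sin (2 * ∑ i, (k i : ℝ) * x i)) := by
    intro x
    rw [mEps, Real.sin_two_mul]; ring
  simp_rw [e]
  rw [integral_const_mul, integral_add (aux_int d _ (by fun_prop)) (aux_int d _ (by fun_prop)),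
    integral_const_mul, aux_sin d k hk, aux_sin2 d k hk]
  ring

lemma aux_pd (d : ℕ) (k : Fin d → ℤ) (ε : ℝ) (i : Fin d) (x : Fin d → ℝ) :
    pd (mEps d k ε) i x =
      ((2 * π) ^ d)⁻¹ * (2 * ε * (-Real.sin (∑ i, (k i : ℝ) * x i) * k i)) := by
  have h1 : HasFDerivAt (fun x : Fin d → ℝ => ∑ i, (k i : ℝ) * x i)
      (∑ i, (k i : ℝ) • (ContinuousLinearMap.proj i : (Fin d → ℝ) →L[ℝ] ℝ)) x := by
    apply HasFDerivAt.fun_sum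
    intro j _
    exact (hasFDerivAt_apply j x).const_mul (k j : ℝ)
  have h2 := ((h1.cos.const_mul (2 * ε)).const_add 1).const_mul (((2 * π) ^ d)⁻¹)
  have h3 : HasFDerivAt (mEps d k ε) _ x := h2
  rw [pd, h3.fderiv]
  simp [Pi.single_apply]

lemma aux_den (d : ℕ) (k : Fin d → ℤ) (ε : ℝ) (hε : ε ∈ Set.Ioo (0:ℝ) (1/4)) (x : Fin d → ℝ) :
    1 / 2 ≤ 1 + 2 * ε * Real.cos (∑ i, (k i : ℝ) * x i) := by
  have := Real.neg_one_le_cos (∑ i, (k i : ℝ) * x i)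
  nlinarith [hε.1, hε.2]

lemma aux_fisher (d : ℕ) (k : Fin d → ℤ) (ε : ℝ) (hε : ε ∈ Set.Ioo (0:ℝ) (1/4)) :
    (∫ x in torusBox d, (∑ i, (pd (mEps d k ε) i x) ^ 2) / mEps d k ε x) =
        (4 * ε ^ 2 * (∑ i, ((k i : ℝ)) ^ 2) / (2 * π) ^ d) *
          ∫ x in torusBox d,
            (Real.sin (∑ i, (k i : ℝ) * x i)) ^ 2 /
              (1 + 2 * ε * Real.cos (∑ i, (k i : ℝ) * x i)) := by
  have hp : (2 * π) ^ d ≠ 0 := by positivity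
  rw [← integral_const_mul]
  congr 1; ext x
  have h := aux_den d k ε hε x
  have e : ∑ i, (pd (mEps d k ε) i x) ^ 2 =
      (((2 * π) ^ d)⁻¹ * (2 * ε * Real.sin (∑ i, (k i : ℝ) * x i))) ^ 2 *
        ∑ i, ((k i : ℝ)) ^ 2 := by
    rw [Finset.mul_sum]
    congr 1; ext i
    rw [aux_pd]; ring
  rw [e, mEps]
  generalize (∑ i, ((k i : ℝ)) ^ 2) = K at *
  generalize (2 * π) ^ d = P at *
  generalize (∑ i, (k i : ℝ) * x i) = s at *
  have h' : 1 + 2 * ε * Real.cos s ≠ 0 := by linarith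
  generalize 1 + 2 * ε * Real.cos s = D at *
  field_simp
  ring

lemma aux_lim (d : ℕ) (k : Fin d → ℤ) :
    Tendsto (fun ε : ℝ => ∫ x in torusBox d,
            (Real.sin (∑ i, (k i : ℝ) * x i)) ^ 2 /
              (1 + 2 * ε * Real.cos (∑ i, (k i : ℝ) * x i)))
      (nhdsWithin 0 (Set.Ioi 0))
      (nhds (∫ x in torusBox d, Real.sin (∑ i, (k i : ℝ) * x i) ^ 2)) := by
  apply tendsto_integral_filter_of_dominated_convergence (fun _ => (2:ℝ))
  · refine Eventually.of_forall fun ε => Measurable.aestronglyMeasurable ?_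
    fun_prop
  · filter_upwards [Ioo_mem_nhdsGT (show (0:ℝ) < 1/4 by norm_num)] with ε hε
    refine Eventually.of_forall fun x => ?_
    have h := aux_den d k ε hε x
    rw [Real.norm_of_nonneg (div_nonneg (sq_nonneg _) (by linarith)), div_le_iff₀ (by linarith)]
    have := Real.sin_sq_le_one (∑ i, (k i : ℝ) * x i)
    linarith
  · exact aux_int d _ continuous_const
  · refine Eventually.of_forall fun x => ?_
    have : ContinuousAt (fun ε : ℝ => (Real.sin (∑ i, (k i : ℝ) * x i)) ^ 2 /
              (1 + 2 * ε * Real.cos (∑ i, (k i : ℝ) * x i))) 0 := by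
      apply ContinuousAt.div
      · fun_prop
      · fun_prop
      · simp
    have h := this.tendsto.mono_left (nhdsWithin_le_nhds (s := Set.Ioi 0))
    simpa using h

/-- For `k ∈ ℤ^d \ {0}` and `ε ∈ (0,1/4)`, the function `m_ε` is a
strictly positive probability density on `𝕋^d`, with `q_k(m_ε) = ε²` and Fisher
information `I(m_ε) = (4ε²|k|²/(2π)^d) ∫ sin²(k·x)/(1+2ε cos(k·x)) dx`; moreover
`I(m_ε)/(2|k|²ε²) → 1` as `ε ↓ 0`. -/
theorem perturbed_density_properties (d : ℕ) (k : Fin d → ℤ) (hk : k ≠ 0) :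
    (∀ ε ∈ Set.Ioo (0:ℝ) (1/4),
      (∀ x, 0 < mEps d k ε x) ∧
      (∫ x in torusBox d, mEps d k ε x) = 1 ∧
      ((∫ x in torusBox d, Real.cos (∑ i, (k i : ℝ) * x i) * mEps d k ε x) ^ 2 +
        (∫ x in torusBox d, Real.sin (∑ i, (k i : ℝ) * x i) * mEps d k ε x) ^ 2) = ε ^ 2 ∧
      (∫ x in torusBox d, (∑ i, (pd (mEps d k ε) i x) ^ 2) / mEps d k ε x) =
        (4 * ε ^ 2 * (∑ i, ((k i : ℝ)) ^ 2) / (2 * π) ^ d) *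
          ∫ x in torusBox d,
            (Real.sin (∑ i, (k i : ℝ) * x i)) ^ 2 /
              (1 + 2 * ε * Real.cos (∑ i, (k i : ℝ) * x i))) ∧
    Tendsto
      (fun ε : ℝ =>
        (∫ x in torusBox d, (∑ i, (pd (mEps d k ε) i x) ^ 2) / mEps d k ε x) /
          (2 * (∑ i, ((k i : ℝ)) ^ 2) * ε ^ 2))
      (nhdsWithin 0 (Set.Ioi 0)) (nhds 1) := by
  constructor
  · intro ε hε
    refine ⟨fun x => ?_, aux_mass d k hk ε, ?_, aux_fisher d k ε hε⟩
    · have h := aux_den d k ε hε x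
      exact mul_pos (by positivity) (by linarith)
    · rw [aux_qc d k hk, aux_qs d k hk]; ring
  · have hp : (2 * π) ^ d ≠ 0 := by positivity
    have hK : (∑ i, ((k i : ℝ)) ^ 2) ≠ 0 := by
      obtain ⟨i, hi⟩ := Function.ne_iff.mp hk
      have hi' : (k i : ℝ) ≠ 0 := by exact_mod_cast hi
      apply ne_of_gt
      exact Finset.sum_pos' (fun _ _ => sq_nonneg _) ⟨i, Finset.mem_univ i, by positivity⟩
    have h := (aux_lim d k).const_mul (2 / (2 * π) ^ d)
    rw [aux_sinsq d k hk] at h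
    have e : 2 / (2 * π) ^ d * ((2 * π) ^ d * (1 / 2)) = 1 := by field_simp
    rw [e] at h
    refine h.congr' ?_
    filter_upwards [Ioo_mem_nhdsGT (show (0:ℝ) < 1/4 by norm_num)] with ε hε
    rw [aux_fisher d k ε hε]
    have : ε ≠ 0 := hε.1.ne'
    generalize (∑ i, ((k i : ℝ)) ^ 2) = K at *
    generalize (2 * π) ^ d = P at *
    field_simp
    ring
end

section
/- Let ρ : ℝ → ℝ be a continuously differentiable, strictly positive, 2π-periodic function with ∫₀^{2π} ρ(y) dy = 1. Then ∫₀^{2π} |ρ'(y)|²/ρ(y) dy ≥ 2 [ (∫₀^{2π} cos(y) ρ(y) dy)² + (∫₀^{2π} sin(y) ρ(y) dy)² ]. -/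
open Real MeasureTheory

lemma aux_trig0 (c0 c1 c2 c3 c4 s1 s2 s3 s4 : ℝ) :
    (∫ y in (0:ℝ)..(2 * π), (c0 + c1 * cos y + s1 * sin y + c2 * cos (2 * y) + s2 * sin (2 * y)
      + c3 * cos (3 * y) + s3 * sin (3 * y) + c4 * cos (4 * y) + s4 * sin (4 * y)))
      = 2 * π * c0 := by
  have hd : ∀ y : ℝ, HasDerivAt (fun y : ℝ => c0 * y + c1 * sin y - s1 * cos y
      + c2 * (sin (2 * y) / 2) - s2 * (cos (2 * y) / 2)
      + c3 * (sin (3 * y) / 3) - s3 * (cos (3 * y) / 3)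
      + c4 * (sin (4 * y) / 4) - s4 * (cos (4 * y) / 4))
      (c0 + c1 * cos y + s1 * sin y + c2 * cos (2 * y) + s2 * sin (2 * y)
      + c3 * cos (3 * y) + s3 * sin (3 * y) + c4 * cos (4 * y) + s4 * sin (4 * y)) y := by
    intro y
    have hs : ∀ k : ℝ, HasDerivAt (fun y : ℝ => sin (k * y)) (cos (k * y) * k) y := fun k => by
      simpa using ((hasDerivAt_id y).const_mul k).sin
    have hc : ∀ k : ℝ, HasDerivAt (fun y : ℝ => cos (k * y)) (-sin (k * y) * k) y := fun k => by
      simpa using ((hasDerivAt_id y).const_mul k).cos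
    have := (((((((((hasDerivAt_id y).const_mul c0).add ((hasDerivAt_sin y).const_mul c1)).sub
      ((hasDerivAt_cos y).const_mul s1)).add (((hs 2).div_const 2).const_mul c2)).sub
      (((hc 2).div_const 2).const_mul s2)).add (((hs 3).div_const 3).const_mul c3)).sub
      (((hc 3).div_const 3).const_mul s3)).add (((hs 4).div_const 4).const_mul c4)).sub
      (((hc 4).div_const 4).const_mul s4)
    refine this.congr_deriv ?_
    ring
  rw [intervalIntegral.integral_eq_sub_of_hasDerivAt (fun y _ => hd y)
    (Continuous.intervalIntegrable (by fun_prop) _ _)]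
  have e1 : ∀ n : ℕ, sin ((n:ℝ) * (2 * π)) = 0 := fun n => by
    have := Real.sin_nat_mul_pi (n * 2)
    push_cast at this
    rw [← this]; ring_nf
  have e2 : ∀ n : ℕ, cos ((n:ℝ) * (2 * π)) = 1 := fun n => Real.cos_nat_mul_two_pi n
  have a2 := e1 2
  have a3 := e1 3
  have a4 := e1 4
  have b2 := e2 2
  have b3 := e2 3
  have b4 := e2 4
  push_cast at a2 a3 a4 b2 b3 b4
  simp only [a2, a3, a4, b2, b3, b4, sin_two_pi, cos_two_pi, mul_zero, sin_zero, cos_zero]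
  ring

lemma aux_trig (a b c d e a' b' c' d' e' : ℝ) :
    (∫ y in (0:ℝ)..(2 * π), (a + b * cos y + c * sin y + d * cos (2 * y) + e * sin (2 * y)) *
      (a' + b' * cos y + c' * sin y + d' * cos (2 * y) + e' * sin (2 * y)))
      = 2 * π * (a * a' + (b * b' + c * c' + d * d' + e * e') / 2) := by
  rw [← aux_trig0 (a * a' + (b * b' + c * c' + d * d' + e * e') / 2)
    (a * b' + b * a' + (b * d' + d * b' + c * e' + e * c') / 2)
    (a * d' + d * a' + (b * b' - c * c') / 2)
    ((b * d' + d * b' - c * e' - e * c') / 2)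
    ((d * d' - e * e') / 2)
    (a * c' + c * a' + (b * e' + e * b' - c * d' - d * c') / 2)
    (a * e' + e * a' + (b * c' + c * b') / 2)
    ((b * e' + e * b' + c * d' + d * c') / 2)
    ((d * e' + e * d') / 2)]
  refine intervalIntegral.integral_congr fun y _ => ?_
  have h := Real.sin_sq_add_cos_sq y
  have h4 : cos (4 * y) = 2 * cos (2 * y) ^ 2 - 1 := by
    rw [show 4 * y = 2 * (2 * y) by ring, Real.cos_two_mul]
  have h4' : sin (4 * y) = 2 * sin (2 * y) * cos (2 * y) := by
    rw [show 4 * y = 2 * (2 * y) by ring, Real.sin_two_mul]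
  have h3 : cos (3 * y) = cos (2 * y) * cos y - sin (2 * y) * sin y := by
    rw [show 3 * y = 2 * y + y by ring, Real.cos_add]
  have h3' : sin (3 * y) = sin (2 * y) * cos y + cos (2 * y) * sin y := by
    rw [show 3 * y = 2 * y + y by ring, Real.sin_add]
  have h1 : cos y = cos (2 * y) * cos y + sin (2 * y) * sin y := by
    rw [← Real.cos_sub]; ring_nf
  have h1' : sin y = sin (2 * y) * cos y - cos (2 * y) * sin y := by
    rw [← Real.sin_sub]; ring_nf
  have g := Real.sin_sq_add_cos_sq (2 * y)
  have k1 : cos y ^ 2 = (1 + cos (2 * y)) / 2 := by rw [Real.cos_two_mul]; ring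
  have k2 : sin y ^ 2 = (1 - cos (2 * y)) / 2 := by rw [Real.cos_two_mul]; linarith
  have k3 : cos y * sin y = sin (2 * y) / 2 := by rw [Real.sin_two_mul]; ring
  simp only [h4, h4', h3, h3']
  linear_combination (b * b') * k1 + c * c' * k2 + (b * c' + c * b') * k3
    - (b * d' + d * b' + c * e' + e * c') / 2 * h1
    - (b * e' + e * b' - c * d' - d * c') / 2 * h1'
    + e * e' * g

lemma aux_coeff (u : ℝ → ℝ) (hu : Continuous u) (hab : (0:ℝ) < 2 * π) (n : ℤ) :
    ‖fourierCoeffOn hab (fun x => (u x : ℂ)) n‖ ^ 2 =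
      ((∫ y in (0:ℝ)..(2 * π), u y * cos (n * y)) ^ 2 +
        (∫ y in (0:ℝ)..(2 * π), u y * sin (n * y)) ^ 2) / (2 * π) ^ 2 := by
  rw [fourierCoeffOn_eq_integral]
  have : (∫ x in (0:ℝ)..(2 * π), fourier (-n) (x : AddCircle (2 * π - 0)) • (u x : ℂ)) =
      ((∫ y in (0:ℝ)..(2 * π), u y * cos (n * y) : ℝ) : ℂ)
      - ((∫ y in (0:ℝ)..(2 * π), u y * sin (n * y) : ℝ) : ℂ) * Complex.I := by
    rw [← intervalIntegral.integral_ofReal, ← intervalIntegral.integral_ofReal,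
      ← intervalIntegral.integral_mul_const, ← intervalIntegral.integral_sub]
    · refine intervalIntegral.integral_congr fun y _ => ?_
      simp only [fourier_coe_apply, smul_eq_mul]
      have : (2 * (π:ℂ) * Complex.I * ((-n : ℤ) : ℂ) * y / ((2 * π - 0 : ℝ) : ℂ))
          = ((-(n * y) : ℝ) : ℂ) * Complex.I := by
        have : (π : ℂ) ≠ 0 := by exact_mod_cast Real.pi_ne_zero
        push_cast
        field_simp
        ring
      rw [this, Complex.exp_mul_I, ← Complex.ofReal_cos, ← Complex.ofReal_sin, Real.cos_neg,
        Real.sin_neg]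
      push_cast
      ring
    · exact Continuous.intervalIntegrable (by fun_prop) _ _
    · exact Continuous.intervalIntegrable (by fun_prop) _ _
  rw [this, norm_smul, mul_pow, ← Complex.normSq_eq_norm_sq (_ - _), Complex.normSq_apply]
  simp [abs_of_pos Real.pi_pos]
  field_simp

lemma aux_wirt (u v : ℝ → ℝ) (hu : ∀ x, HasDerivAt u (v x) x) (hv : Continuous v)
    (hper : u (2 * π) = u 0) :
    4 * (∫ y in (0:ℝ)..(2 * π), u y ^ 2) - 4 * (∫ y in (0:ℝ)..(2 * π), u y) ^ 2 / (2 * π)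
      - 3 * ((∫ y in (0:ℝ)..(2 * π), u y * cos y) ^ 2 +
        (∫ y in (0:ℝ)..(2 * π), u y * sin y) ^ 2) / π ≤ ∫ y in (0:ℝ)..(2 * π), v y ^ 2 := by
  have hab : (0:ℝ) < 2 * π := by positivity
  have hcu : Continuous u := continuous_iff_continuousAt.2 fun x => (hu x).continuousAt
  have key : ∀ f : ℝ → ℝ, Continuous f →
      HasSum (fun i => ‖fourierCoeffOn hab (fun x => (f x : ℂ)) i‖ ^ 2)
        ((2 * π)⁻¹ * ∫ x in (0:ℝ)..(2 * π), f x ^ 2) := by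
    intro f hf
    have hf' : Continuous (fun x => (f x : ℂ)) := by fun_prop
    have hm : MemLp (fun x => (f x : ℂ)) 2 (volume.restrict (Set.Ioc 0 (2 * π))) := by
      rw [memLp_two_iff_integrable_sq_norm hf'.aestronglyMeasurable]
      have : Continuous (fun x => ‖(f x : ℂ)‖ ^ 2) := by fun_prop
      exact (this.intervalIntegrable 0 (2 * π)).1
    have := hasSum_sq_fourierCoeffOn hab hm
    simpa using this
  have hsu := key u hcu
  have hsv := key v hv
  set c := fun i => ‖fourierCoeffOn hab (fun x => (u x : ℂ)) i‖ ^ 2 with hc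
  have hrel : ∀ n : ℤ, n ≠ 0 →
      (n:ℝ) ^ 2 * c n = ‖fourierCoeffOn hab (fun x => (v x : ℂ)) n‖ ^ 2 := by
    intro n hn
    have h := fourierCoeffOn_of_hasDerivAt hab (f := fun x => (u x : ℂ))
      (f' := fun x => (v x : ℂ)) hn (fun x _ => (hu x).ofReal_comp)
      (Continuous.intervalIntegrable (by fun_prop) _ _)
    have hn' : (n : ℝ) ≠ 0 := by exact_mod_cast hn
    simp only [hc]
    rw [h, hper]
    simp [abs_of_pos Real.pi_pos, mul_pow]
    field_simp
  have hfin := ((hasSum_ite_eq (0:ℤ) (4 * c 0)).add (hasSum_ite_eq (1:ℤ) (3 * c 1))).add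
    (hasSum_ite_eq (-1:ℤ) (3 * c (-1)))
  have hle := hasSum_le (fun n => ?_) ((hsu.mul_left 4).sub hfin) hsv
  · have c0 := aux_coeff u hcu hab 0
    have c1 := aux_coeff u hcu hab 1
    have c2 := aux_coeff u hcu hab (-1)
    simp at c0 c1 c2
    simp only [hc] at hle
    rw [c0, c1, c2] at hle
    have := mul_le_mul_of_nonneg_left hle hab.le
    have hpi := Real.pi_pos
    field_simp at this ⊢
    linarith
  · have hcn : 0 ≤ c n := by simp only [hc]; positivity
    by_cases h0 : n = 0
    · subst h0
      simp [hc]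
    · rw [← hrel n h0]
      by_cases h1 : n = 1
      · subst h1
        simp [hc]; linarith
      by_cases h2 : n = -1
      · subst h2
        simp [hc]; linarith
      simp only [h0, h1, h2, if_false]
      have : (4:ℝ) ≤ (n:ℝ) ^ 2 := by
        have h : 2 ≤ |n| := by
          rcases abs_cases n with h | h <;> omega
        have : (2:ℝ) ≤ |(n:ℝ)| := by exact_mod_cast h
        rw [← sq_abs]; nlinarith
      have := mul_le_mul_of_nonneg_right this hcn
      simp only [hc] at this ⊢
      linarith

lemma aux_main (u v : ℝ → ℝ) (hu : ∀ x, HasDerivAt u (v x) x) (hv : Continuous v)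
    (hper : u (2 * π) = u 0) (C S : ℝ) :
    2 * (∫ y in (0:ℝ)..(2 * π), (C * cos y + S * sin y) * u y ^ 2) ≤
      2 * (∫ y in (0:ℝ)..(2 * π), v y ^ 2)
        + (C ^ 2 + S ^ 2) * (∫ y in (0:ℝ)..(2 * π), u y ^ 2) := by
  have hcu : Continuous u := continuous_iff_continuousAt.2 fun x => (hu x).continuousAt
  have hW := aux_wirt u v hu hv hper
  have hpi := Real.pi_pos
  obtain ⟨a, ha⟩ : ∃ a, (∫ y in (0:ℝ)..(2 * π), u y) = 2 * π * a :=
    ⟨(∫ y in (0:ℝ)..(2 * π), u y) / (2 * π), by field_simp⟩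
  obtain ⟨b, hb⟩ : ∃ b, (∫ y in (0:ℝ)..(2 * π), u y * cos y) = π * b :=
    ⟨(∫ y in (0:ℝ)..(2 * π), u y * cos y) / π, by field_simp⟩
  obtain ⟨d, hd⟩ : ∃ d, (∫ y in (0:ℝ)..(2 * π), u y * sin y) = π * d :=
    ⟨(∫ y in (0:ℝ)..(2 * π), u y * sin y) / π, by field_simp⟩
  rw [ha, hb, hd] at hW
  have hE : 0 ≤ ∫ y in (0:ℝ)..(2 * π),
      ((C ^ 2 + S ^ 2 + 7 - 2 * (C * cos y + S * sin y)) * (u y - (a + b * cos y + d * sin y)) ^ 2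
      + ((C * b - S * d) * cos (2 * y) + (C * d + S * b) * sin (2 * y)
        - (u y - (a + b * cos y + d * sin y))) ^ 2) := by
    refine intervalIntegral.integral_nonneg (by positivity) fun y _ => ?_
    have : 0 ≤ C ^ 2 + S ^ 2 + 7 - 2 * (C * cos y + S * sin y) := by
      nlinarith [sq_nonneg (C - cos y), sq_nonneg (S - sin y), Real.sin_sq_add_cos_sq y]
    positivity
  have hexp : (∫ y in (0:ℝ)..(2 * π),
      ((C ^ 2 + S ^ 2 + 7 - 2 * (C * cos y + S * sin y)) * (u y - (a + b * cos y + d * sin y)) ^ 2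
      + ((C * b - S * d) * cos (2 * y) + (C * d + S * b) * sin (2 * y)
        - (u y - (a + b * cos y + d * sin y))) ^ 2)) =
      ∫ y in (0:ℝ)..(2 * π), ((C ^ 2 + S ^ 2 + 8) * u y ^ 2
        - 2 * ((C * cos y + S * sin y) * u y ^ 2)
        + (-2 * (C ^ 2 + S ^ 2 + 8) * a + 2 * (C * b + S * d)) * u y
        + (-2 * (C ^ 2 + S ^ 2 + 8) * b + 4 * a * C) * (u y * cos y)
        + (-2 * (C ^ 2 + S ^ 2 + 8) * d + 4 * a * S) * (u y * sin y)
        + ((C ^ 2 + S ^ 2 + 7) + (-2 * C) * cos y + (-2 * S) * sin y + 0 * cos (2 * y)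
            + 0 * sin (2 * y)) *
          ((a ^ 2 + (b ^ 2 + d ^ 2) / 2) + (2 * a * b) * cos y + (2 * a * d) * sin y
            + ((b ^ 2 - d ^ 2) / 2) * cos (2 * y) + (b * d) * sin (2 * y))
        + (a + b * cos y + d * sin y + (C * b - S * d) * cos (2 * y)
            + (C * d + S * b) * sin (2 * y)) *
          (a + b * cos y + d * sin y + (C * b - S * d) * cos (2 * y)
            + (C * d + S * b) * sin (2 * y))) := by
    refine intervalIntegral.integral_congr fun y _ => ?_
    have h := Real.sin_sq_add_cos_sq y
    have hs2 : sin y ^ 2 = 1 - cos y ^ 2 := by linarith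
    have k1 : cos y ^ 2 = (1 + cos (2 * y)) / 2 := by rw [Real.cos_two_mul]; ring
    have k2 : sin y ^ 2 = (1 - cos (2 * y)) / 2 := by rw [Real.cos_two_mul]; linarith
    have k3 : cos y * sin y = sin (2 * y) / 2 := by rw [Real.sin_two_mul]; ring
    linear_combination
      ((C ^ 2 + S ^ 2 + 7 - 2 * (C * cos y + S * sin y)) * b ^ 2 + 4 * C * b * u y) * k1
      + ((C ^ 2 + S ^ 2 + 7 - 2 * (C * cos y + S * sin y)) * d ^ 2 + 4 * S * d * u y) * k2
      + ((C ^ 2 + S ^ 2 + 7 - 2 * (C * cos y + S * sin y)) * 2 * b * d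
        + 4 * (C * d + S * b) * u y) * k3
  rw [hexp] at hE
  rw [intervalIntegral.integral_add, intervalIntegral.integral_add, intervalIntegral.integral_add,
    intervalIntegral.integral_add, intervalIntegral.integral_add, intervalIntegral.integral_sub,
    aux_trig, aux_trig] at hE
  · simp only [intervalIntegral.integral_const_mul] at hE
    rw [ha, hb, hd] at hE
    have e1 : 4 * (2 * π * a) ^ 2 / (2 * π) = 8 * π * a ^ 2 := by field_simp; ring
    have e2 : 3 * ((π * b) ^ 2 + (π * d) ^ 2) / π = 3 * π * (b ^ 2 + d ^ 2) := by field_simp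
    rw [e1, e2] at hW
    have q1 := mul_nonneg hpi.le (sq_nonneg (b - a * C))
    have q2 := mul_nonneg hpi.le (sq_nonneg (d - a * S))
    linarith
  all_goals exact Continuous.intervalIntegrable (by fun_prop) _ _

/-- For a `C¹`, strictly positive, `2π`-periodic probability density
`ρ` on the one-dimensional torus, the Fisher information `∫ |ρ'|²/ρ` dominates twice the
squared modulus of the first Fourier coefficient:
`∫ |ρ'|²/ρ ≥ 2[(∫ cos y ρ(y) dy)² + (∫ sin y ρ(y) dy)²]`. -/
theorem fisher_information_first_fourier (ρ : ℝ → ℝ) (hρ : ContDiff ℝ 1 ρ)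
    (hpos : ∀ y, 0 < ρ y) (hper : Function.Periodic ρ (2 * π))
    (hmass : (∫ y in (0:ℝ)..(2 * π), ρ y) = 1) :
    2 * ((∫ y in (0:ℝ)..(2 * π), Real.cos y * ρ y) ^ 2 +
          (∫ y in (0:ℝ)..(2 * π), Real.sin y * ρ y) ^ 2) ≤
      ∫ y in (0:ℝ)..(2 * π), (deriv ρ y) ^ 2 / ρ y := by
  have hc : Continuous ρ := hρ.continuous
  have hc' : Continuous (deriv ρ) := hρ.continuous_deriv le_rfl
  have hsq : ∀ y, √(ρ y) ^ 2 = ρ y := fun y => Real.sq_sqrt (hpos y).le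
  have h0 : ∀ y, 2 * √(ρ y) ≠ 0 := fun y => by
    have := Real.sqrt_pos.2 (hpos y); positivity
  have h := aux_main (fun y => √(ρ y)) (fun y => deriv ρ y / (2 * √(ρ y)))
    (fun y => ((hρ.differentiable one_ne_zero y).hasDerivAt).sqrt (hpos y).ne')
    (hc'.div (by fun_prop) h0)
    (by have := hper 0; simp only [zero_add] at this; simp only [this])
    (∫ y in (0:ℝ)..(2 * π), Real.cos y * ρ y) (∫ y in (0:ℝ)..(2 * π), Real.sin y * ρ y)
  simp only [hsq, div_pow, mul_pow, hmass] at h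
  generalize hC : (∫ y in (0:ℝ)..(2 * π), Real.cos y * ρ y) = C at *
  generalize hS : (∫ y in (0:ℝ)..(2 * π), Real.sin y * ρ y) = S at *
  have e1 : (∫ y in (0:ℝ)..(2 * π), (C * cos y + S * sin y) * ρ y) = C * C + S * S := by
    have e : C * C + S * S = C * (∫ y in (0:ℝ)..(2 * π), Real.cos y * ρ y)
        + S * (∫ y in (0:ℝ)..(2 * π), Real.sin y * ρ y) := by rw [hC, hS]
    rw [e, ← intervalIntegral.integral_const_mul, ← intervalIntegral.integral_const_mul,
      ← intervalIntegral.integral_add]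
    · refine intervalIntegral.integral_congr fun y _ => ?_
      ring
    all_goals exact Continuous.intervalIntegrable (by fun_prop) _ _
  have e2 : (∫ y in (0:ℝ)..(2 * π), deriv ρ y ^ 2 / (2 ^ 2 * ρ y))
      = (1 / 4) * ∫ y in (0:ℝ)..(2 * π), (deriv ρ y) ^ 2 / ρ y := by
    rw [← intervalIntegral.integral_const_mul]
    refine intervalIntegral.integral_congr fun y _ => ?_
    have := (hpos y).ne'
    field_simp
    norm_num
  rw [e1, e2] at h
  linarith
end

section
/- Let m be a twice continuously differentiable, strictly positive probability density on the torus 𝕋^d and let k ∈ ℤ^d with k ≠ 0. Let μ be the probability measure on 𝕋^d with density m, and suppose that the pushforward of μ under the map x ↦ (k·x mod 2π) has a continuously differentiable, strictly positive density ρ on 𝕋 = ℝ/2πℤ. Then ∫₀^{2π} |ρ'(y)|²/ρ(y) dy ≤ |k|^{-2} ∫_{[0,2π]^d} |∇m(x)|²/m(x) dx. -/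
open Real MeasureTheory

open scoped Pointwise in
lemma aux_translate (d : ℕ) (f : (Fin d → ℝ) → ℝ)
    (hf : ∀ (x : Fin d → ℝ) (i : Fin d), f (x + Pi.single i (2 * π)) = f x)
    (v : Fin d → ℝ) : (∫ x in torusBox d, f (x + v)) = ∫ x in torusBox d, f x := by
  have hpi : (2 * π) ≠ 0 := by positivity
  have hpos : 0 < 2 * π := by positivity
  let b : Module.Basis (Fin d) ℝ (Fin d → ℝ) :=
    (Pi.basisFun ℝ (Fin d)).isUnitSMul (w := fun _ => 2 * π) (fun _ => IsUnit.mk0 _ hpi)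
  have hb : ∀ i, b i = Pi.single i (2 * π) := by
    intro i
    simp only [b, Module.Basis.isUnitSMul_apply, Pi.basisFun_apply]
    rw [← Pi.single_smul]
    simp
  have hD : ZSpan.fundamentalDomain b = Set.pi Set.univ fun _ : Fin d => Set.Ico (0 : ℝ) (2 * π) := by
    ext x
    simp only [ZSpan.mem_fundamentalDomain, b, Module.Basis.repr_isUnitSMul, Set.mem_pi,
      Set.mem_univ, true_implies, Pi.basisFun_repr, Set.mem_Ico, Units.smul_def, smul_eq_mul,
      Units.val_inv_eq_inv_val, IsUnit.unit_spec]
    refine forall_congr' fun i => ?_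
    rw [inv_mul_lt_iff₀ hpos, mul_one]
    refine and_congr ?_ Iff.rfl
    constructor
    · intro h
      have := mul_nonneg hpos.le h
      rwa [mul_inv_cancel_left₀ hpi] at this
    · intro h; positivity
  have hae : (torusBox d) =ᵐ[volume] ZSpan.fundamentalDomain b := by
    rw [hD]
    exact (Measure.univ_pi_Ico_ae_eq_Icc (f := (0 : Fin d → ℝ)) (g := fun _ => 2 * π)).symm
  have hinv : ∀ g ∈ Submodule.span ℤ (Set.range b), ∀ x, f (g + x) = f x := by
    intro g hg
    induction hg using Submodule.span_induction with
    | mem y hy =>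
      obtain ⟨i, rfl⟩ := hy
      intro x
      rw [hb, add_comm, hf]
    | zero => simp
    | add y z _ _ h1 h2 => intro x; rw [add_assoc, h1, h2]
    | smul a y _ h =>
      intro x
      have hper : Function.Periodic f y := fun x => by rw [add_comm, h]
      rw [add_comm]
      exact hper.zsmul a x
  rw [setIntegral_congr_set hae, setIntegral_congr_set hae]
  have h1 := ZSpan.isAddFundamentalDomain b (volume : Measure (Fin d → ℝ))
  have h2 : IsAddFundamentalDomain (Submodule.span ℤ (Set.range b))
    (v +ᵥ ZSpan.fundamentalDomain b) volume := h1.vadd_of_comm v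
  haveI : VAddInvariantMeasure (Submodule.span ℤ (Set.range b)) (Fin d → ℝ) volume :=
    ⟨fun c s _ => measure_preimage_add volume c.1 s⟩
  have h3 := h2.setIntegral_eq h1 (f := f) (fun g x => hinv g.1 g.2 x)
  rw [← h3]
  have h4 := (measurePreserving_add_left (volume : Measure (Fin d → ℝ)) v).setIntegral_image_emb
    (measurableEmbedding_addLeft v) f (ZSpan.fundamentalDomain b)
  simp only [add_comm _ v]
  exact h4.symm

lemma aux_deriv {E : Type*} [NormedAddCommGroup E] [MeasurableSpace E] [BorelSpace E]
    [SecondCountableTopology E]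
    (μ : Measure E) [IsFiniteMeasureOnCompacts μ] (K : Set E) (hK : IsCompact K)
    (w : E → ℝ) (hw : Continuous w) (u u' : ℝ → E → ℝ) (hu : ∀ t, Continuous (u t))
    (hu' : Continuous (fun p : ℝ × E => u' p.1 p.2))
    (hd : ∀ t x, HasDerivAt (fun s => u s x) (u' t x) t) :
    HasDerivAt (fun t => ∫ x in K, w x * u t x ∂μ) (∫ x in K, w x * u' 0 x ∂μ) 0 := by
  have hF : Continuous (fun p : ℝ × E => w p.2 * u' p.1 p.2) := (hw.comp continuous_snd).mul hu'
  obtain ⟨C, hC⟩ := ((isCompact_Icc (a := (-1:ℝ)) (b := 1)).prod hK).exists_bound_of_continuousOn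
    hF.continuousOn
  have hu0 : Continuous (u' 0) := hu'.comp (Continuous.prodMk_right (0:ℝ))
  refine (hasDerivAt_integral_of_dominated_loc_of_deriv_le (F := fun t x => w x * u t x)
    (F' := fun t x => w x * u' t x) (bound := fun _ => C) (s := Set.Icc (-1) 1)
    (Icc_mem_nhds (by norm_num) (by norm_num)) ?_ ?_ ?_ ?_ ?_ ?_).2
  · exact Filter.Eventually.of_forall fun t => (hw.mul (hu t)).aestronglyMeasurable
  · exact (hw.mul (hu 0)).continuousOn.integrableOn_compact hK
  · exact (hw.mul hu0).aestronglyMeasurable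
  · refine (ae_restrict_iff' hK.measurableSet).2 (Filter.Eventually.of_forall ?_)
    intro x hx t ht
    exact hC (t, x) ⟨ht, hx⟩
  · exact continuousOn_const.integrableOn_compact hK
  · exact Filter.Eventually.of_forall fun x t _ => (hd t x).const_mul _

lemma aux_shift (d : ℕ) (m : (Fin d → ℝ) → ℝ)
    (hmper : ∀ (x : Fin d → ℝ) (i : Fin d), m (x + Pi.single i (2 * π)) = m x)
    (k : Fin d → ℤ) (ρ : ℝ → ℝ)
    (hρper : Function.Periodic ρ (2 * π))
    (hpush : ∀ φ : ℝ → ℝ, Continuous φ → Function.Periodic φ (2 * π) →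
      (∫ x in torusBox d, φ (∑ i, (k i : ℝ) * x i) * m x) =
        ∫ y in (0:ℝ)..(2 * π), φ y * ρ y)
    (φ : ℝ → ℝ) (hφ : Continuous φ) (hφp : Function.Periodic φ (2 * π)) (t : ℝ) :
    (∫ x in torusBox d, φ (∑ i, (k i : ℝ) * x i) * m (x + t • (fun i => (k i : ℝ)))) =
      ∫ y in (0:ℝ)..(2 * π), φ y * ρ (y + t * ∑ i, (k i : ℝ) ^ 2) := by
  set S := ∑ i, (k i : ℝ) ^ 2 with hS
  have h1 := hpush (fun y => φ (y - t * S)) (by fun_prop) (fun y => by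
    show φ (y + 2 * π - t * S) = _
    rw [add_sub_right_comm, hφp])
  have h2 := aux_translate d (fun x => φ ((∑ i, (k i : ℝ) * x i) - t * S) * m x) (by
    intro x i
    have : (∑ j, (k j : ℝ) * (x + (Pi.single i (2 * π) : Fin d → ℝ)) j) - t * S
        = ((∑ j, (k j : ℝ) * x j) - t * S) + (k i) * (2 * π) := by
      simp only [Pi.add_apply, mul_add, Finset.sum_add_distrib]
      simp [Pi.single_apply]
      ring
    simp only [this, hmper]
    rw [hφp.int_mul (k i)]) (t • (fun i => (k i : ℝ)))
  have h3 : ∀ x : Fin d → ℝ, (∑ j, (k j : ℝ) * (x + t • (fun i => (k i : ℝ))) j) - t * S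
      = ∑ j, (k j : ℝ) * x j := by
    intro x
    simp only [Pi.add_apply, mul_add, Finset.sum_add_distrib, Pi.smul_apply, smul_eq_mul, hS,
      Finset.mul_sum]
    rw [add_sub_assoc, add_eq_left, sub_eq_zero]
    exact Finset.sum_congr rfl fun i _ => by ring
  simp only [h3] at h2
  rw [h2, h1]
  have h4 := intervalIntegral.integral_comp_sub_right (a := 0) (b := 2 * π)
    (fun y => φ y * ρ (y + t * S)) (t * S)
  simp only [sub_add_cancel] at h4
  rw [h4]
  have hp : Function.Periodic (fun y => φ y * ρ (y + t * S)) (2 * π) := by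
    intro y
    show φ (y + 2 * π) * ρ (y + 2 * π + t * S) = _
    rw [hφp, add_right_comm, hρper]
  have := hp.intervalIntegral_add_eq (0 - t * S) 0
  rw [zero_add] at this
  rw [← this]
  congr 1
  ring

lemma aux_key (d : ℕ) (m : (Fin d → ℝ) → ℝ) (hm : ContDiff ℝ 2 m)
    (hmper : ∀ (x : Fin d → ℝ) (i : Fin d), m (x + Pi.single i (2 * π)) = m x)
    (k : Fin d → ℤ) (ρ : ℝ → ℝ) (hρ : ContDiff ℝ 1 ρ)
    (hρper : Function.Periodic ρ (2 * π))
    (hpush : ∀ φ : ℝ → ℝ, Continuous φ → Function.Periodic φ (2 * π) →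
      (∫ x in torusBox d, φ (∑ i, (k i : ℝ) * x i) * m x) =
        ∫ y in (0:ℝ)..(2 * π), φ y * ρ y)
    (φ : ℝ → ℝ) (hφ : Continuous φ) (hφp : Function.Periodic φ (2 * π)) :
    (∫ x in torusBox d, φ (∑ i, (k i : ℝ) * x i) * fderiv ℝ m x (fun i => (k i : ℝ))) =
      (∑ i, (k i : ℝ) ^ 2) * ∫ y in (0:ℝ)..(2 * π), φ y * deriv ρ y := by
  have hpos : 0 ≤ 2 * π := by positivity
  have hsh := aux_shift d m hmper k ρ hρper hpush φ hφ hφp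
  set S := ∑ i, (k i : ℝ) ^ 2 with hS
  set κ : Fin d → ℝ := fun i => (k i : ℝ) with hκ
  have hm0 := hm.continuous
  have hm1 : Continuous (fderiv ℝ m) := hm.continuous_fderiv (by norm_num)
  have hρ0 := hρ.continuous
  have hρ1 : Continuous (deriv ρ) := hρ.continuous_deriv (by norm_num)
  have hA := aux_deriv (volume : Measure (Fin d → ℝ)) (torusBox d) isCompact_Icc
    (fun x => φ (∑ i, (k i : ℝ) * x i)) (by fun_prop) (fun t x => m (x + t • κ))
    (fun t x => fderiv ℝ m (x + t • κ) κ) (fun t => by fun_prop) (by fun_prop) (by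
      intro t x
      have h1 : HasDerivAt (fun s : ℝ => x + s • κ) κ t := by
        simpa using ((hasDerivAt_id t).smul_const κ).const_add x
      exact ((hm.differentiable (by norm_num)) _).hasFDerivAt.comp_hasDerivAt t h1)
  have hB := aux_deriv (volume : Measure ℝ) (Set.Icc 0 (2 * π)) isCompact_Icc
    φ hφ (fun t y => ρ (y + t * S))
    (fun t y => deriv ρ (y + t * S) * S) (fun t => by fun_prop) (by fun_prop) (by
      intro t x
      have h1 : HasDerivAt (fun s : ℝ => x + s * S) S t := by
        simpa using ((hasDerivAt_id t).mul_const S).const_add x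
      exact ((hρ.differentiable (by norm_num)) _).hasDerivAt.comp t h1)
  have hfun : (fun t : ℝ => ∫ x in torusBox d, φ (∑ i, (k i : ℝ) * x i) * m (x + t • κ)) =
      fun t => ∫ y in Set.Icc 0 (2 * π), φ y * ρ (y + t * S) := by
    funext t
    rw [hsh t, intervalIntegral.integral_of_le hpos, integral_Icc_eq_integral_Ioc]
  rw [hfun] at hA
  have h := hA.unique hB
  simp only [zero_smul, add_zero, zero_mul] at h
  rw [h, intervalIntegral.integral_of_le hpos, ← integral_Icc_eq_integral_Ioc,
    ← integral_const_mul]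
  congr 1
  funext y
  ring

/-- Let `m` be a `C²`, strictly positive probability density on `𝕋^d`,
`k ∈ ℤ^d \ {0}`, and suppose the pushforward of the measure `m(x)dx` under
`x ↦ k·x mod 2π` has a `C¹`, strictly positive density `ρ` on `𝕋 = ℝ/2πℤ` (expressed via
integration of arbitrary continuous `2π`-periodic test functions). Then
`I(ρ) ≤ |k|^{-2} I(m)`. -/
theorem pushforward_fisher_information (d : ℕ) (m : (Fin d → ℝ) → ℝ)
    (hm : ContDiff ℝ 2 m) (hmpos : ∀ x, 0 < m x)
    (hmper : ∀ (x : Fin d → ℝ) (i : Fin d), m (x + Pi.single i (2 * π)) = m x)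
    (hmass : (∫ x in torusBox d, m x) = 1)
    (k : Fin d → ℤ) (hk : k ≠ 0)
    (ρ : ℝ → ℝ) (hρ : ContDiff ℝ 1 ρ) (hρpos : ∀ y, 0 < ρ y)
    (hρper : Function.Periodic ρ (2 * π))
    (hpush : ∀ φ : ℝ → ℝ, Continuous φ → Function.Periodic φ (2 * π) →
      (∫ x in torusBox d, φ (∑ i, (k i : ℝ) * x i) * m x) =
        ∫ y in (0:ℝ)..(2 * π), φ y * ρ y) :
    (∫ y in (0:ℝ)..(2 * π), (deriv ρ y) ^ 2 / ρ y) ≤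
      (∑ i, ((k i : ℝ)) ^ 2)⁻¹ * ∫ x in torusBox d, (∑ i, (pd m i x) ^ 2) / m x := by
  have hpi : 0 ≤ 2 * π := by positivity
  have hm0 := hm.continuous
  have hm1 : Continuous (fderiv ℝ m) := hm.continuous_fderiv (by norm_num)
  have hρ0 := hρ.continuous
  have hρ1 : Continuous (deriv ρ) := hρ.continuous_deriv (by norm_num)
  have hρ1p : Function.Periodic (deriv ρ) (2 * π) := by
    intro y
    rw [← deriv_comp_add_const]
    congr 1
    funext z
    exact hρper z
  have hgc : Continuous (fun y => deriv ρ y / ρ y) := hρ1.div hρ0 fun y => (hρpos y).ne'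
  have hgp : Function.Periodic (fun y => deriv ρ y / ρ y) (2 * π) := by
    intro y
    show deriv ρ (y + 2 * π) / ρ (y + 2 * π) = _
    rw [hρ1p, hρper]
  obtain ⟨g, hg⟩ : ∃ g : ℝ → ℝ, g = fun y => deriv ρ y / ρ y := ⟨_, rfl⟩
  rw [← hg] at hgc hgp
  have e1 := aux_key d m hm hmper k ρ hρ hρper hpush g hgc hgp
  have e2 := hpush (fun y => g y ^ 2) (by fun_prop) (fun y => by
    show g (y + 2 * π) ^ 2 = _
    rw [hgp])
  have r1 : (fun y => g y * deriv ρ y) = fun y => (deriv ρ y) ^ 2 / ρ y := by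
    funext y; rw [hg]; ring
  have r2 : (fun y => g y ^ 2 * ρ y) = fun y => (deriv ρ y) ^ 2 / ρ y := by
    funext y
    have := (hρpos y).ne'
    rw [hg]; field_simp
  rw [r1] at e1
  rw [r2] at e2
  set J := ∫ y in (0:ℝ)..(2 * π), (deriv ρ y) ^ 2 / ρ y with hJ
  set S := ∑ i, (k i : ℝ) ^ 2 with hS
  have hSpos : 0 < S := by
    obtain ⟨i, hi⟩ := Function.ne_iff.1 hk
    refine Finset.sum_pos' (fun i _ => sq_nonneg _) ⟨i, Finset.mem_univ i, ?_⟩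
    have : (k i : ℝ) ≠ 0 := by exact_mod_cast hi
    positivity
  have hpdc : ∀ i, Continuous (pd m i) := fun i => by unfold pd; fun_prop
  have c1 : Continuous fun x : Fin d → ℝ =>
    g (∑ i, (k i : ℝ) * x i) * fderiv ℝ m x (fun i => (k i : ℝ)) := by fun_prop
  have c2 : Continuous fun x : Fin d → ℝ => g (∑ i, (k i : ℝ) * x i) ^ 2 * m x := by fun_prop
  have c3 : Continuous fun x : Fin d → ℝ => (∑ i, (pd m i x) ^ 2) / m x :=
    Continuous.div (by fun_prop) hm0 fun x => (hmpos x).ne'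
  have hK : IsCompact (torusBox d) := isCompact_Icc
  have i1 := c1.continuousOn.integrableOn_compact (μ := volume) hK
  have i2 := c2.continuousOn.integrableOn_compact (μ := volume) hK
  have i3 := c3.continuousOn.integrableOn_compact (μ := volume) hK
  have hle : (∫ x in torusBox d, g (∑ i, (k i : ℝ) * x i) * fderiv ℝ m x (fun i => (k i : ℝ))) ≤
      ∫ x in torusBox d, ((S / 2) * (g (∑ i, (k i : ℝ) * x i) ^ 2 * m x) +
        (1 / 2) * ((∑ i, (pd m i x) ^ 2) / m x)) := by
    refine integral_mono i1 ((i2.const_mul _).add (i3.const_mul _)) fun x => ?_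
    have ha : fderiv ℝ m x (fun i => (k i : ℝ)) = ∑ i, (k i : ℝ) * pd m i x := by
      have : (fun i => (k i : ℝ)) = ∑ i, (k i : ℝ) • (Pi.single i 1 : Fin d → ℝ) := by
        funext j
        simp [Finset.sum_apply, Pi.single_apply]
      rw [this, map_sum]
      simp [pd]
    have hcs := Finset.sum_mul_sq_le_sq_mul_sq Finset.univ (fun i => (k i : ℝ)) (fun i => pd m i x)
    rw [← ha, ← hS] at hcs
    show g (∑ i, (k i : ℝ) * x i) * fderiv ℝ m x (fun i => (k i : ℝ)) ≤
      (S / 2) * (g (∑ i, (k i : ℝ) * x i) ^ 2 * m x) + (1 / 2) * ((∑ i, (pd m i x) ^ 2) / m x)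
    generalize g (∑ i, (k i : ℝ) * x i) = G at *
    generalize fderiv ℝ m x (fun i => (k i : ℝ)) = a at *
    generalize (∑ i, (pd m i x) ^ 2) = P at *
    have hmx := hmpos x
    generalize m x = M at *
    have h5 : (S / 2) * (G ^ 2 * M) + (1 / 2) * (P / M) - G * a
        = (S ^ 2 * G ^ 2 * M ^ 2 + S * P - 2 * S * M * G * a) / (2 * S * M) := by
      field_simp
    have h6 : 0 ≤ (S ^ 2 * G ^ 2 * M ^ 2 + S * P - 2 * S * M * G * a) / (2 * S * M) := by
      apply div_nonneg _ (by positivity)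
      nlinarith [sq_nonneg (S * M * G - a)]
    linarith
  rw [integral_add (i2.const_mul _) (i3.const_mul _), integral_const_mul, integral_const_mul,
    e1, e2] at hle
  rw [inv_mul_eq_div, le_div_iff₀ hSpos]
  linarith
end

section
/- Under the hypotheses of the stationary duality identity — ν, ρ > 0; for i = 1, 2, u_i, m_i C² and 2π-periodic, m_i > 0 probability densities with m_i = exp(−u_i/ν)/∫exp(−u_i/ν), f_i continuous, ρ u_i − ν Δu_i + ½|∇u_i|² = f_i and ν Δm_i + ∇·(m_i∇u_i) = 0 — assume additionally that ∫_{[0,2π]^d} (f_1 − f_2)(m_1 − m_2) dx ≥ 0. Then m_1 = m_2. -/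
open Real MeasureTheory

theorem pd_contDiff {d : ℕ} {u : (Fin d → ℝ) → ℝ} (hu : ContDiff ℝ 2 u) (i : Fin d) :
    ContDiff ℝ 1 (pd u i) := by
  have h : ContDiff ℝ 1 (fderiv ℝ u) := hu.fderiv_right (by norm_num)
  exact h.clm_apply contDiff_const

theorem pd_continuous {d : ℕ} {u : (Fin d → ℝ) → ℝ} (hu : ContDiff ℝ 1 u) (i : Fin d) :
    Continuous (pd u i) := by
  have h : Continuous (fderiv ℝ u) := hu.continuous_fderiv (by norm_num)
  exact h.clm_apply continuous_const

theorem pd_periodic {d : ℕ} {u : (Fin d → ℝ) → ℝ} (i : Fin d) (v : Fin d → ℝ)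
    (h : ∀ x, u (x + v) = u x) (x : Fin d → ℝ) : pd u i (x + v) = pd u i x := by
  unfold pd
  rw [← fderiv_comp_add_right]
  simp only [h]

theorem pd_sub_mul {d : ℕ} {a b m n : (Fin d → ℝ) → ℝ} (x : Fin d → ℝ) (i : Fin d)
    (ha : DifferentiableAt ℝ a x) (hb : DifferentiableAt ℝ b x)
    (hm : DifferentiableAt ℝ m x) (hn : DifferentiableAt ℝ n x) :
    pd (fun y => (a y - b y) * (m y - n y)) i x =
      (pd a i x - pd b i x) * (m x - n x) + (a x - b x) * (pd m i x - pd n i x) := by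
  unfold pd
  have h := (ha.hasFDerivAt.sub hb.hasFDerivAt).mul (hm.hasFDerivAt.sub hn.hasFDerivAt)
  have h' : HasFDerivAt (fun y => (a y - b y) * (m y - n y)) _ x := h
  rw [h'.fderiv]
  simp
  ring

theorem pd_gibbs {d : ℕ} {u m : (Fin d → ℝ) → ℝ} {ν Z : ℝ} (x : Fin d → ℝ) (i : Fin d)
    (hu : DifferentiableAt ℝ u x) (hm : ∀ x, m x = Real.exp (-u x / ν) / Z) :
    pd m i x = - (m x * pd u i x) / ν := by
  unfold pd
  have h := ((hu.hasFDerivAt.neg.mul_const ν⁻¹).exp).mul_const Z⁻¹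
  have e : m = fun x => Real.exp (-u x * ν⁻¹) * Z⁻¹ := by
    funext x; rw [hm]; simp only [div_eq_mul_inv]
  have h' : HasFDerivAt m _ x := e ▸ h
  rw [h'.fderiv, e]
  simp
  ring

theorem torus_div_zero {d : ℕ} (F : Fin d → (Fin d → ℝ) → ℝ) (hF : ∀ i, ContDiff ℝ 1 (F i))
    (hp : ∀ i x, F i (x + Pi.single i (2 * π)) = F i x) :
    ∫ x in torusBox d, ∑ i, pd (F i) i x = 0 := by
  cases d with
  | zero => simp
  | succ n =>
    have hle : (0 : Fin (n+1) → ℝ) ≤ fun _ => 2 * π := fun i => by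
      have := Real.pi_pos
      simp only [Pi.zero_apply]; positivity
    have h := integral_divergence_of_hasFDerivAt_off_countable' (0 : Fin (n+1) → ℝ)
      (fun _ => 2 * π) hle F (fun i x => fderiv ℝ (F i) x) ∅ Set.countable_empty
      (fun i => (hF i).continuous.continuousOn)
      (fun x _ i => ((hF i).differentiable (by norm_num) x).hasFDerivAt)
      (by
        have : Continuous (fun x => ∑ i, pd (F i) i x) :=
          continuous_finsetSum _ fun i _ => pd_continuous (hF i) i
        exact this.continuousOn.integrableOn_compact isCompact_Icc)
    refine Eq.trans h ?_
    refine Finset.sum_eq_zero fun i _ => ?_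
    rw [sub_eq_zero]
    congr 1
    funext x
    rw [← hp i (i.insertNth ((0 : Fin (n+1) → ℝ) i) x)]
    congr 1
    funext j
    refine Fin.succAboveCases i ?_ (fun k => ?_) j
    · simp
    · simp [Fin.succAbove_ne]

theorem periodic_eq {d : ℕ} (g : (Fin d → ℝ) → ℝ)
    (hp : ∀ x (i : Fin d), g (x + Pi.single i (2 * π)) = g x)
    (h0 : ∀ x ∈ torusBox d, g x = 0) (x : Fin d → ℝ) : g x = 0 := by
  have hz : ∀ (i : Fin d) (n : ℤ) x, g (x + Pi.single i (n * (2 * π))) = g x := by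
    intro i n x
    have hper : Function.Periodic g (Pi.single i (2 * π)) := fun x => hp x i
    have := hper.zsmul n x
    rw [← this]
    congr 2
    rw [← Pi.single_smul]; simp
  have hs : ∀ (n : Fin d → ℤ) (s : Finset (Fin d)) x,
      g (x + ∑ i ∈ s, Pi.single i (n i * (2 * π))) = g x := by
    intro n s
    induction s using Finset.induction_on with
    | empty => simp
    | insert a s ha ih =>
      intro x
      rw [Finset.sum_insert ha, ← add_assoc, ih, hz]
  have hpos : (0:ℝ) < 2 * π := Real.two_pi_pos
  rw [← hs (fun i => - toIcoDiv hpos 0 (x i)) Finset.univ x]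
  apply h0
  rw [Finset.univ_sum_single (fun i => ((- toIcoDiv hpos 0 (x i) : ℤ) : ℝ) * (2 * π))]
  have key : ∀ i, x i + ((- toIcoDiv hpos 0 (x i) : ℤ) : ℝ) * (2 * π) = toIcoMod hpos 0 (x i) := by
    intro i
    have h := self_sub_toIcoDiv_zsmul hpos 0 (x i)
    rw [zsmul_eq_mul] at h
    rw [← h]
    push_cast
    ring
  refine ⟨fun i => ?_, fun i => ?_⟩
  · rw [Pi.add_apply, key]
    exact (toIcoMod_mem_Ico' hpos (x i)).1
  · rw [Pi.add_apply, key]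
    exact (toIcoMod_mem_Ico' hpos (x i)).2.le

theorem eq_zero_on_box {d : ℕ} (G : (Fin d → ℝ) → ℝ) (hG : Continuous G) (h0 : ∀ x, 0 ≤ G x)
    (hi : ∫ x in torusBox d, G x ≤ 0) : ∀ x ∈ torusBox d, G x = 0 := by
  have hint : IntegrableOn G (torusBox d) := hG.continuousOn.integrableOn_compact isCompact_Icc
  have hz : ∫ x in torusBox d, G x = 0 := le_antisymm hi (integral_nonneg h0)
  rw [integral_eq_zero_iff_of_nonneg h0 hint] at hz
  refine Measure.eqOn_of_ae_eq hz hG.continuousOn continuousOn_const ?_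
  have hc : Convex ℝ (torusBox d) := convex_Icc _ _
  have hne : (interior (torusBox d)).Nonempty := by
    refine ⟨fun _ => π, mem_interior_iff_mem_nhds.2 (pi_Icc_mem_nhds ?_ ?_)⟩
    · intro i; exact Real.pi_pos
    · intro i; linarith [Real.pi_pos]
  rw [hc.closure_interior_eq_closure_of_nonempty_interior hne]
  exact subset_closure

theorem log_mul_nonneg {a b : ℝ} (ha : 0 < a) (hb : 0 < b) :
    0 ≤ (Real.log a - Real.log b) * (a - b) := by
  rcases le_total a b with h | h
  · exact mul_nonneg_of_nonpos_of_nonpos (by linarith [Real.log_le_log ha h]) (by linarith)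
  · exact mul_nonneg (by linarith [Real.log_le_log hb h]) (by linarith)

theorem log_mul_eq_zero {a b : ℝ} (ha : 0 < a) (hb : 0 < b)
    (h : (Real.log a - Real.log b) * (a - b) = 0) : a = b := by
  rcases mul_eq_zero.1 h with h | h
  · exact Real.log_injOn_pos ha hb (by linarith)
  · linarith

/-- Under the hypotheses of the stationary duality identity, if in
addition the Lasry–Lions monotonicity `∫ (f₁−f₂)(m₁−m₂) ≥ 0` holds at the two
stationary equilibrium densities, then `m₁ = m₂`. -/
theorem stationary_equilibrium_uniqueness_of_monotone (d : ℕ) (ν ρ : ℝ) (hν : 0 < ν) (hρ : 0 < ρ)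
    (u₁ u₂ m₁ m₂ : (Fin d → ℝ) → ℝ) (f₁ f₂ : (Fin d → ℝ) → ℝ)
    (hu₁ : ContDiff ℝ 2 u₁) (hu₂ : ContDiff ℝ 2 u₂)
    (hm₁ : ContDiff ℝ 2 m₁) (hm₂ : ContDiff ℝ 2 m₂)
    (hf₁ : Continuous f₁) (hf₂ : Continuous f₂)
    (huper₁ : ∀ (x : Fin d → ℝ) (i : Fin d), u₁ (x + Pi.single i (2 * π)) = u₁ x)
    (huper₂ : ∀ (x : Fin d → ℝ) (i : Fin d), u₂ (x + Pi.single i (2 * π)) = u₂ x)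
    (hmper₁ : ∀ (x : Fin d → ℝ) (i : Fin d), m₁ (x + Pi.single i (2 * π)) = m₁ x)
    (hmper₂ : ∀ (x : Fin d → ℝ) (i : Fin d), m₂ (x + Pi.single i (2 * π)) = m₂ x)
    (hfper₁ : ∀ (x : Fin d → ℝ) (i : Fin d), f₁ (x + Pi.single i (2 * π)) = f₁ x)
    (hfper₂ : ∀ (x : Fin d → ℝ) (i : Fin d), f₂ (x + Pi.single i (2 * π)) = f₂ x)
    (hmpos₁ : ∀ x, 0 < m₁ x) (hmpos₂ : ∀ x, 0 < m₂ x)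
    (hmass₁ : (∫ x in torusBox d, m₁ x) = 1) (hmass₂ : (∫ x in torusBox d, m₂ x) = 1)
    (hgibbs₁ : ∀ x, m₁ x =
      Real.exp (-u₁ x / ν) / ∫ y in torusBox d, Real.exp (-u₁ y / ν))
    (hgibbs₂ : ∀ x, m₂ x =
      Real.exp (-u₂ x / ν) / ∫ y in torusBox d, Real.exp (-u₂ y / ν))
    (hHJB₁ : ∀ x, ρ * u₁ x - ν * (∑ i, pd (pd u₁ i) i x) +
      (1 / 2) * (∑ i, (pd u₁ i x) ^ 2) = f₁ x)
    (hHJB₂ : ∀ x, ρ * u₂ x - ν * (∑ i, pd (pd u₂ i) i x) +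
      (1 / 2) * (∑ i, (pd u₂ i x) ^ 2) = f₂ x)
    (hFP₁ : ∀ x, ν * (∑ i, pd (pd m₁ i) i x) +
      (∑ i, pd (fun y => m₁ y * pd u₁ i y) i x) = 0)
    (hFP₂ : ∀ x, ν * (∑ i, pd (pd m₂ i) i x) +
      (∑ i, pd (fun y => m₂ y * pd u₂ i y) i x) = 0)
    (hmono : 0 ≤ ∫ x in torusBox d, (f₁ x - f₂ x) * (m₁ x - m₂ x)) :
    m₁ = m₂ := by
  set Z₁ := ∫ y in torusBox d, Real.exp (-u₁ y / ν) with hZ₁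
  set Z₂ := ∫ y in torusBox d, Real.exp (-u₂ y / ν) with hZ₂
  have hZp : ∀ (u m : (Fin d → ℝ) → ℝ) (Z : ℝ), (∀ x, 0 < m x) →
      (∀ x, m x = Real.exp (-u x / ν) / Z) → ∀ x, u x = -ν * (Real.log (m x) + Real.log Z) := by
    intro u m Z hm hg x
    have h := hm x
    rw [hg x] at h
    have hZ : 0 < Z := by
      by_contra hc
      exact absurd h (not_lt.2 (div_nonpos_of_nonneg_of_nonpos (Real.exp_pos _).le (not_lt.1 hc)))
    rw [hg x, Real.log_div (Real.exp_pos _).ne' hZ.ne', Real.log_exp]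
    field_simp
    ring
  have hl₁ := hZp u₁ m₁ Z₁ hmpos₁ hgibbs₁
  have hl₂ := hZp u₂ m₂ Z₂ hmpos₂ hgibbs₂
  let F : Fin d → (Fin d → ℝ) → ℝ := fun i y => (pd u₁ i y - pd u₂ i y) * (m₁ y - m₂ y)
  have hFc : ∀ i, ContDiff ℝ 1 (F i) := fun i =>
    ((pd_contDiff hu₁ i).sub (pd_contDiff hu₂ i)).mul
      ((hm₁.of_le (by norm_num)).sub (hm₂.of_le (by norm_num)))
  have hFp : ∀ i x, F i (x + Pi.single i (2 * π)) = F i x := by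
    intro i x
    simp only [F]
    rw [pd_periodic i _ (fun x => huper₁ x i), pd_periodic i _ (fun x => huper₂ x i),
      hmper₁, hmper₂]
  have hdiv := torus_div_zero F hFc hFp
  let G : (Fin d → ℝ) → ℝ := fun x =>
    ρ * ν * ((Real.log (m₁ x) - Real.log (m₂ x)) * (m₁ x - m₂ x)) +
      1 / 2 * (m₁ x + m₂ x) * ∑ i, (pd u₁ i x - pd u₂ i x) ^ 2
  have cm₁ := hm₁.continuous
  have cm₂ := hm₂.continuous
  have cF : Continuous (fun x => ∑ i, pd (F i) i x) :=
    continuous_finsetSum _ fun i _ => pd_continuous (hFc i) i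
  have hGc : Continuous G := by
    have h1 := cm₁.log (fun x => (hmpos₁ x).ne')
    have h2 := cm₂.log (fun x => (hmpos₂ x).ne')
    have h3 : Continuous (fun x => ∑ i, (pd u₁ i x - pd u₂ i x) ^ 2) :=
      continuous_finsetSum _ fun i _ =>
        ((pd_contDiff hu₁ i).continuous.sub (pd_contDiff hu₂ i).continuous).pow 2
    exact (continuous_const.mul ((h1.sub h2).mul (cm₁.sub cm₂))).add
      ((continuous_const.mul (cm₁.add cm₂)).mul h3)
  have hA0 : ∀ x, 0 ≤ ρ * ν * ((Real.log (m₁ x) - Real.log (m₂ x)) * (m₁ x - m₂ x)) := fun x =>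
    mul_nonneg (mul_pos hρ hν).le (log_mul_nonneg (hmpos₁ x) (hmpos₂ x))
  have hB0 : ∀ x, 0 ≤ 1 / 2 * (m₁ x + m₂ x) * ∑ i, (pd u₁ i x - pd u₂ i x) ^ 2 := fun x =>
    mul_nonneg (by linarith [hmpos₁ x, hmpos₂ x]) (Finset.sum_nonneg fun i _ => sq_nonneg _)
  have hG0 : ∀ x, 0 ≤ G x := fun x => add_nonneg (hA0 x) (hB0 x)
  let c : ℝ := -ρ * ν * (Real.log Z₁ - Real.log Z₂)
  have hpt : ∀ x, (f₁ x - f₂ x) * (m₁ x - m₂ x) =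
      c * (m₁ x - m₂ x) - G x - ν * ∑ i, pd (F i) i x := by
    intro x
    have e : ∀ i, ν * pd (F i) i x = ν * (pd (pd u₁ i) i x - pd (pd u₂ i) i x) * (m₁ x - m₂ x)
        - (pd u₁ i x - pd u₂ i x) * (m₁ x * pd u₁ i x - m₂ x * pd u₂ i x) := by
      intro i
      simp only [F]
      rw [pd_sub_mul x i ((pd_contDiff hu₁ i).differentiable (by norm_num) x)
        ((pd_contDiff hu₂ i).differentiable (by norm_num) x)
        (hm₁.differentiable (by norm_num) x) (hm₂.differentiable (by norm_num) x),
        pd_gibbs x i (hu₁.differentiable (by norm_num) x) hgibbs₁,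
        pd_gibbs x i (hu₂.differentiable (by norm_num) x) hgibbs₂]
      field_simp
      ring
    have hS : ν * ∑ i, pd (F i) i x =
        ν * ((∑ i, pd (pd u₁ i) i x) - ∑ i, pd (pd u₂ i) i x) * (m₁ x - m₂ x)
        - 1 / 2 * ((∑ i, (pd u₁ i x) ^ 2) - ∑ i, (pd u₂ i x) ^ 2) * (m₁ x - m₂ x)
        - 1 / 2 * (m₁ x + m₂ x) * ∑ i, (pd u₁ i x - pd u₂ i x) ^ 2 := by
      rw [Finset.mul_sum]
      simp only [← Finset.sum_sub_distrib, Finset.mul_sum, Finset.sum_mul]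
      refine Finset.sum_congr rfl fun i _ => ?_
      rw [e i]; ring
    rw [hS, ← hHJB₁ x, ← hHJB₂ x]
    simp only [G, c]
    have a1 := hl₁ x
    have a2 := hl₂ x
    linear_combination (ρ * (m₁ x - m₂ x)) * (a1 - a2)
  have iI : ∀ {g : (Fin d → ℝ) → ℝ}, Continuous g → Integrable g (volume.restrict (torusBox d)) :=
    fun hg => hg.continuousOn.integrableOn_compact isCompact_Icc
  have hGi : ∫ x in torusBox d, G x ≤ 0 := by
    have i1 : Integrable (fun x => c * (m₁ x - m₂ x)) (volume.restrict (torusBox d)) :=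
      iI (continuous_const.mul (cm₁.sub cm₂))
    have i2 : Integrable (fun x => c * (m₁ x - m₂ x) - G x) (volume.restrict (torusBox d)) :=
      i1.sub (iI hGc)
    rw [integral_congr_ae (Filter.Eventually.of_forall hpt),
      integral_sub i2 ((iI cF).const_mul ν),
      integral_sub i1 (iI hGc), integral_const_mul,
      integral_const_mul, hdiv, integral_sub (iI cm₁) (iI cm₂), hmass₁, hmass₂] at hmono
    linarith
  have hG := eq_zero_on_box G hGc hG0 hGi
  funext x
  have := periodic_eq (fun x => m₁ x - m₂ x) (fun x i => by simp only [hmper₁, hmper₂])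
    (fun x hx => by
      have h := hG x hx
      have hA : ρ * ν * ((Real.log (m₁ x) - Real.log (m₂ x)) * (m₁ x - m₂ x)) = 0 :=
        le_antisymm (by have := hB0 x; simp only [G] at h; linarith) (hA0 x)
      have := log_mul_eq_zero (hmpos₁ x) (hmpos₂ x)
        ((mul_eq_zero.1 hA).resolve_left (mul_pos hρ hν).ne')
      simp [this]) x
  exact sub_eq_zero.1 this
end
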